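/- arXiv:math/0501430 — 5 statements merged into one kernel-verified Lean document; each statement's English description precedes it below -/
import Mathlib

section
/- Let L be a lattice with a least element and let L^ω denote the lattice of all sequences ℕ → L with componentwise lattice operations. Then the tensor product M₃ ⊗ L^ω is a lattice if and only if L is n-modular for some n > 0. -/
section TensorDefs

variable {α β : Type*} [Lattice α] [OrderBot α] [Lattice β] [OrderBot β]

/-- `∇ = (A × {0}) ∪ ({0} × B)`. -/
def nablaSet (α β : Type*) [Lattice α] [OrderBot α] [Lattice β] [OrderBot β] :
    Set (α × β) :=
  {p | p.1 = ⊥ ∨ p.2 = ⊥}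

/-- A *bi-ideal* of `A × B`: a down-set containing `∇` and closed under joins in each
coordinate separately. -/
def IsBiIdeal (I : Set (α × β)) : Prop :=
  IsLowerSet I ∧ nablaSet α β ⊆ I ∧
  (∀ a₀ a₁ b, (a₀, b) ∈ I → (a₁, b) ∈ I → (a₀ ⊔ a₁, b) ∈ I) ∧
  (∀ a b₀ b₁, (a, b₀) ∈ I → (a, b₁) ∈ I → (a, b₀ ⊔ b₁) ∈ I)

/-- Membership in the tensor product `A ⊗ B`: the bi-ideals that are finite joins of
pure tensors `a ⊗ b`, i.e. the smallest bi-ideal containing some finite subset of `A × B`. -/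
def InTensor (I : Set (α × β)) : Prop :=
  ∃ s : Finset (α × β), I = ⋂₀ {J : Set (α × β) | IsBiIdeal J ∧ ↑s ⊆ J}

end TensorDefs

/-- The tensor product `A ⊗ B`, as a partially ordered set (ordered by inclusion). -/
abbrev TensorProd (α β : Type*) [Lattice α] [OrderBot α] [Lattice β] [OrderBot β] :=
  {I : Set (α × β) // InTensor I}
/-- `M` is the lattice `M₃`: it consists of the five distinct elements `⊥, a, b, c, ⊤`,
where `a`, `b`, `c` are three atoms with pairwise meets `⊥` and pairwise joins `⊤`. -/
def IsM3 (M : Type*) [Lattice M] [BoundedOrder M] (a b c : M) : Prop :=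
  (∀ x : M, x = ⊥ ∨ x = a ∨ x = b ∨ x = c ∨ x = ⊤) ∧
  a ≠ b ∧ a ≠ c ∧ b ≠ c ∧ a ≠ ⊥ ∧ b ≠ ⊥ ∧ c ≠ ⊥ ∧ a ≠ ⊤ ∧ b ≠ ⊤ ∧ c ≠ ⊤ ∧
  (⊥ : M) ≠ ⊤ ∧
  a ⊓ b = ⊥ ∧ a ⊓ c = ⊥ ∧ b ⊓ c = ⊥ ∧ a ⊔ b = ⊤ ∧ a ⊔ c = ⊤ ∧ b ⊔ c = ⊤

/-- One step of the balancing sequence; `adjT^[n] (x,y,z) = (x,y,z)⁽ⁿ⁾`. -/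
def adjT {α : Type*} [Lattice α] (t : α × α × α) : α × α × α :=
  (t.1 ⊔ t.2.1 ⊓ t.2.2, t.2.1 ⊔ t.1 ⊓ t.2.2, t.2.2 ⊔ t.1 ⊓ t.2.1)

/-- A lattice is `n`-modular (satisfies the identity `γₙ : pₙ = pₙ₊₁`). -/
def NModular (α : Type*) [Lattice α] (n : ℕ) : Prop :=
  ∀ t : α × α × α, (adjT^[n] t).1 = (adjT^[n + 1] t).1

section BiSpan

variable {α β : Type*} [Lattice α] [OrderBot α] [Lattice β] [OrderBot β]

/-- The bi-ideal generated by a subset of `α × β`. -/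
def biSpan (s : Set (α × β)) : Set (α × β) :=
  ⋂₀ {J : Set (α × β) | IsBiIdeal J ∧ s ⊆ J}

theorem subset_biSpan (s : Set (α × β)) : s ⊆ biSpan s :=
  Set.subset_sInter fun _ hJ => hJ.2

theorem biSpan_subset {s J : Set (α × β)} (hJ : IsBiIdeal J) (h : s ⊆ J) : biSpan s ⊆ J :=
  Set.sInter_subset_of_mem ⟨hJ, h⟩

theorem isBiIdeal_biSpan (s : Set (α × β)) : IsBiIdeal (biSpan s) := by
  refine ⟨fun p q hpq hp J hJ => hJ.1.1 hpq (hp J hJ), fun p hp J hJ => hJ.1.2.1 hp,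
    fun a₀ a₁ b h₀ h₁ J hJ => hJ.1.2.2.1 _ _ _ (h₀ J hJ) (h₁ J hJ),
    fun a b₀ b₁ h₀ h₁ J hJ => hJ.1.2.2.2 _ _ _ (h₀ J hJ) (h₁ J hJ)⟩

theorem inTensor_biSpan (s : Finset (α × β)) : InTensor (biSpan (s : Set (α × β))) :=
  ⟨s, rfl⟩

/-- The tensor product is always a join-semilattice. -/
theorem TensorProd.exists_isLUB (I J : TensorProd α β) : ∃ K, IsLUB {I, J} K := by
  classical
  obtain ⟨I, s, rfl⟩ := I
  obtain ⟨J, t, rfl⟩ := J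
  refine ⟨⟨_, inTensor_biSpan (s ∪ t)⟩, ?_, ?_⟩
  · rintro K (rfl | rfl)
    · exact biSpan_subset (isBiIdeal_biSpan _) fun p hp => subset_biSpan _ (by simp_all)
    · exact biSpan_subset (isBiIdeal_biSpan _) fun p hp => subset_biSpan _ (by simp_all)
  · rintro ⟨K, u, rfl⟩ hK
    have hs := hK (Set.mem_insert _ _)
    have ht := hK (Set.mem_insert_of_mem _ rfl)
    refine biSpan_subset (isBiIdeal_biSpan _) fun p hp => ?_
    rcases Finset.mem_union.1 hp with h | h
    · exact hs (subset_biSpan _ h)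
    · exact ht (subset_biSpan _ h)

/-- The pure tensor `x ⊗ y`. -/
def pureTensor (x : α) (y : β) : Set (α × β) :=
  {p | p.1 = ⊥ ∨ p.2 = ⊥ ∨ p.1 ≤ x ∧ p.2 ≤ y}

theorem mem_pureTensor_self (x : α) (y : β) : (x, y) ∈ pureTensor x y :=
  Or.inr (Or.inr ⟨le_rfl, le_rfl⟩)

theorem isBiIdeal_pureTensor (x : α) (y : β) : IsBiIdeal (pureTensor x y) := by
  refine ⟨?_, ?_, ?_, ?_⟩
  · rintro ⟨u, v⟩ ⟨u', v'⟩ ⟨hu, hv⟩ (h | h | h)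
    · exact Or.inl (le_bot_iff.1 (hu.trans h.le))
    · exact Or.inr (Or.inl (le_bot_iff.1 (hv.trans h.le)))
    · exact Or.inr (Or.inr ⟨hu.trans h.1, hv.trans h.2⟩)
  · rintro ⟨u, v⟩ (h | h)
    · exact Or.inl h
    · exact Or.inr (Or.inl h)
  · rintro u₀ u₁ v (h₀ | h₀ | h₀) (h₁ | h₁ | h₁) <;> simp_all [pureTensor]
  · rintro u v₀ v₁ (h₀ | h₀ | h₀) (h₁ | h₁ | h₁) <;> simp_all [pureTensor]

theorem pureTensor_subset_iff {x : α} {y : β} {I : Set (α × β)} (hI : IsBiIdeal I) :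
    pureTensor x y ⊆ I ↔ (x, y) ∈ I := by
  refine ⟨fun h => h (mem_pureTensor_self x y), fun h => ?_⟩
  rintro ⟨u, v⟩ (h' | h' | h')
  · exact hI.2.1 (Or.inl h')
  · exact hI.2.1 (Or.inr h')
  · exact hI.1 (show (u, v) ≤ (x, y) from h') h

theorem inTensor_pureTensor (x : α) (y : β) : InTensor (pureTensor x y) := by
  refine ⟨{(x, y)}, Set.Subset.antisymm ?_ ?_⟩
  · exact (pureTensor_subset_iff (isBiIdeal_biSpan _)).2 (subset_biSpan _ (by simp))
  · exact biSpan_subset (isBiIdeal_pureTensor x y) (by simpa using mem_pureTensor_self x y)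

end BiSpan

section AdjT

variable {β : Type*} [Lattice β]

theorem le_adjT (t : β × β × β) : t ≤ adjT t :=
  ⟨le_sup_left, le_sup_left, le_sup_left⟩

theorem monotone_iterate_adjT (t : β × β × β) : Monotone fun n => adjT^[n] t :=
  monotone_nat_of_le_succ fun n => by
    rw [Function.iterate_succ_apply']
    exact le_adjT _

theorem adjT_iterate_apply {ι : Type*} (t : (ι → β) × (ι → β) × (ι → β)) (n : ℕ) (i : ι) :
    adjT^[n] (t.1 i, t.2.1 i, t.2.2 i) =
      ((adjT^[n] t).1 i, (adjT^[n] t).2.1 i, (adjT^[n] t).2.2 i) := by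
  induction n with
  | zero => rfl
  | succ n ih => simp only [Function.iterate_succ_apply', ih]; rfl

theorem NModular.pi {ι : Type*} {n : ℕ} (h : NModular β n) : NModular (ι → β) n := by
  intro t
  funext i
  simpa only [adjT_iterate_apply] using h (t.1 i, t.2.1 i, t.2.2 i)

theorem adjT_iterate_rotate (t : β × β × β) (n : ℕ) :
    adjT^[n] (t.2.1, t.2.2, t.1) =
      ((adjT^[n] t).2.1, (adjT^[n] t).2.2, (adjT^[n] t).1) := by
  induction n with
  | zero => rfl
  | succ n ih => simp only [Function.iterate_succ_apply', ih]; simp only [adjT, inf_comm]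

theorem NModular.adjT_iterate {n : ℕ} (h : NModular β n) (t : β × β × β) :
    adjT (adjT^[n] t) = adjT^[n] t := by
  rw [← Function.iterate_succ_apply' adjT]
  have h₁ := h t
  have h₂ := h (t.2.1, t.2.2, t.1)
  have h₃ := h (t.2.2, t.1, t.2.1)
  have h₄ := adjT_iterate_rotate (t.2.1, t.2.2, t.1)
  simp only [h₄, adjT_iterate_rotate] at h₂ h₃
  exact (Prod.ext h₁ (Prod.ext h₂ h₃)).symm

theorem adjT_inf {s t : β × β × β} (hs : adjT s = s) (ht : adjT t = t) :
    adjT (s ⊓ t) = s ⊓ t := by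
  refine le_antisymm (le_inf ?_ ?_) (le_adjT _)
  · refine le_trans ?_ hs.le
    have h : s ⊓ t ≤ s := inf_le_left
    exact ⟨sup_le_sup h.1 (inf_le_inf h.2.1 h.2.2), sup_le_sup h.2.1 (inf_le_inf h.1 h.2.2),
      sup_le_sup h.2.2 (inf_le_inf h.1 h.2.1)⟩
  · refine le_trans ?_ ht.le
    have h : s ⊓ t ≤ t := inf_le_right
    exact ⟨sup_le_sup h.1 (inf_le_inf h.2.1 h.2.2), sup_le_sup h.2.1 (inf_le_inf h.1 h.2.2),
      sup_le_sup h.2.2 (inf_le_inf h.1 h.2.1)⟩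

end AdjT

section TripleSet

variable {M β : Type*} [Lattice M] [Lattice β] {a b c : M}

/-- The pairs `(u, v)` such that `v` lies below the coordinate of the triple `t` attached to
each of the atoms `a`, `b`, `c` below `u`. It is a bi-ideal as soon as `adjT t = t`. -/
def tripleSet (β : Type*) [Lattice β] (a b c : M) (t : β × β × β) : Set (M × β) :=
  {p | (a ≤ p.1 → p.2 ≤ t.1) ∧ (b ≤ p.1 → p.2 ≤ t.2.1) ∧ (c ≤ p.1 → p.2 ≤ t.2.2)}

theorem tripleSet_mono {s t : β × β × β} (h : s ≤ t) :
    tripleSet β a b c s ⊆ tripleSet β a b c t := fun _ hp =>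
  ⟨fun hu => (hp.1 hu).trans h.1, fun hu => (hp.2.1 hu).trans h.2.1,
    fun hu => (hp.2.2 hu).trans h.2.2⟩

theorem tripleSet_inf (s t : β × β × β) :
    tripleSet β a b c (s ⊓ t) = tripleSet β a b c s ∩ tripleSet β a b c t := by
  ext p
  simp only [tripleSet, Set.mem_ofPred_eq, Set.mem_inter_iff, Prod.fst_inf, Prod.snd_inf, le_inf_iff]
  tauto

theorem isLowerSet_tripleSet (t : β × β × β) : IsLowerSet (tripleSet β a b c t) :=
  fun _ _ h hp => ⟨fun hu => h.2.trans (hp.1 (hu.trans h.1)),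
    fun hu => h.2.trans (hp.2.1 (hu.trans h.1)), fun hu => h.2.trans (hp.2.2 (hu.trans h.1))⟩

theorem sup_right_mem_tripleSet {t : β × β × β} {u : M} {v₀ v₁ : β}
    (h₀ : (u, v₀) ∈ tripleSet β a b c t) (h₁ : (u, v₁) ∈ tripleSet β a b c t) :
    (u, v₀ ⊔ v₁) ∈ tripleSet β a b c t :=
  ⟨fun hu => sup_le (h₀.1 hu) (h₁.1 hu), fun hu => sup_le (h₀.2.1 hu) (h₁.2.1 hu),
    fun hu => sup_le (h₀.2.2 hu) (h₁.2.2 hu)⟩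

end TripleSet

section M3

variable {M : Type*} [Lattice M] [BoundedOrder M] {a b c : M}

theorem IsM3.rotate (hM : IsM3 M a b c) : IsM3 M b c a := by
  obtain ⟨h, h₁, h₂, h₃, h₄, h₅, h₆, h₇, h₈, h₉, h₁₀, h₁₁, h₁₂, h₁₃, h₁₄, h₁₅, h₁₆⟩ := hM
  refine ⟨fun x => ?_, h₃, h₁.symm, h₂.symm, h₅, h₆, h₄, h₈, h₉, h₇, h₁₀, h₁₃,
    inf_comm a b ▸ h₁₁, inf_comm a c ▸ h₁₂, h₁₆, sup_comm a b ▸ h₁₄, sup_comm a c ▸ h₁₅⟩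
  have := h x
  tauto

theorem IsM3.not_le_left (hM : IsM3 M a b c) : ¬a ≤ b := fun h => by
  obtain ⟨-, -, -, -, h₄, -, -, -, -, -, -, h₁₁, -⟩ := hM
  exact h₄ (by rw [← h₁₁, inf_eq_left.2 h])

theorem IsM3.not_le_right (hM : IsM3 M a b c) : ¬a ≤ c := fun h => by
  obtain ⟨-, -, -, -, h₄, -, -, -, -, -, -, -, h₁₂, -⟩ := hM
  exact h₄ (by rw [← h₁₂, inf_eq_left.2 h])

theorem IsM3.le_sup (hM : IsM3 M a b c) {x y : M} (h : a ≤ x ⊔ y) :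
    a ≤ x ∨ a ≤ y ∨ b ≤ x ∧ c ≤ y ∨ c ≤ x ∧ b ≤ y := by
  have hb := hM.not_le_left
  have hc := hM.not_le_right
  rcases hM.1 x with rfl | rfl | rfl | rfl | rfl <;>
    rcases hM.1 y with rfl | rfl | rfl | rfl | rfl <;> simp_all

variable {β : Type*} [Lattice β]

theorem IsM3.sup_left_mem_tripleSet (hM : IsM3 M a b c) {t : β × β × β} {u₀ u₁ : M} {v : β}
    (h₀ : (u₀, v) ∈ tripleSet β a b c t) (h₁ : (u₁, v) ∈ tripleSet β a b c t) :
    (u₀ ⊔ u₁, v) ∈ tripleSet β a b c (adjT t) := by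
  obtain ⟨ha₀, hb₀, hc₀⟩ := h₀
  obtain ⟨ha₁, hb₁, hc₁⟩ := h₁
  refine ⟨fun hu => ?_, fun hu => ?_, fun hu => ?_⟩
  · rcases hM.le_sup hu with h | h | h | h
    · exact le_sup_of_le_left (ha₀ h)
    · exact le_sup_of_le_left (ha₁ h)
    · exact le_sup_of_le_right (le_inf (hb₀ h.1) (hc₁ h.2))
    · exact le_sup_of_le_right (le_inf (hb₁ h.2) (hc₀ h.1))
  · rcases hM.rotate.le_sup hu with h | h | h | h
    · exact le_sup_of_le_left (hb₀ h)
    · exact le_sup_of_le_left (hb₁ h)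
    · exact le_sup_of_le_right (le_inf (ha₁ h.2) (hc₀ h.1))
    · exact le_sup_of_le_right (le_inf (ha₀ h.1) (hc₁ h.2))
  · rcases hM.rotate.rotate.le_sup hu with h | h | h | h
    · exact le_sup_of_le_left (hc₀ h)
    · exact le_sup_of_le_left (hc₁ h)
    · exact le_sup_of_le_right (le_inf (ha₀ h.1) (hb₁ h.2))
    · exact le_sup_of_le_right (le_inf (ha₁ h.2) (hb₀ h.1))

theorem IsM3.mem_tripleSet (hM : IsM3 M a b c) (t : β × β × β) :
    (a, t.1) ∈ tripleSet β a b c t ∧ (b, t.2.1) ∈ tripleSet β a b c t ∧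
      (c, t.2.2) ∈ tripleSet β a b c t := by
  simp [tripleSet, hM.not_le_left, hM.not_le_right, hM.rotate.not_le_left,
    hM.rotate.not_le_right, hM.rotate.rotate.not_le_left, hM.rotate.rotate.not_le_right]

variable [OrderBot β]

theorem IsM3.nablaSet_subset_tripleSet (hM : IsM3 M a b c) (t : β × β × β) :
    nablaSet M β ⊆ tripleSet β a b c t := by
  obtain ⟨-, -, -, -, ha, hb, hc, -⟩ := hM
  rintro ⟨u, v⟩ (rfl | rfl) <;> simp [tripleSet, ha, hb, hc]

theorem IsM3.isBiIdeal_tripleSet (hM : IsM3 M a b c) {t : β × β × β} (ht : adjT t = t) :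
    IsBiIdeal (tripleSet β a b c t) :=
  ⟨isLowerSet_tripleSet t, hM.nablaSet_subset_tripleSet t,
    fun _ _ _ h₀ h₁ => ht ▸ hM.sup_left_mem_tripleSet h₀ h₁,
    fun _ _ _ h₀ h₁ => sup_right_mem_tripleSet h₀ h₁⟩

theorem IsM3.isBiIdeal_iUnion_tripleSet (hM : IsM3 M a b c) (t : β × β × β) :
    IsBiIdeal (⋃ n : ℕ, tripleSet β a b c (adjT^[n] t)) := by
  have key : ∀ {p q : M × β}, p ∈ ⋃ n : ℕ, tripleSet β a b c (adjT^[n] t) →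
      q ∈ ⋃ n : ℕ, tripleSet β a b c (adjT^[n] t) →
      ∃ n, p ∈ tripleSet β a b c (adjT^[n] t) ∧ q ∈ tripleSet β a b c (adjT^[n] t) := by
    intro p q hp hq
    obtain ⟨m, hm⟩ := Set.mem_iUnion.1 hp
    obtain ⟨n, hn⟩ := Set.mem_iUnion.1 hq
    exact ⟨max m n, tripleSet_mono (monotone_iterate_adjT t (le_max_left m n)) hm,
      tripleSet_mono (monotone_iterate_adjT t (le_max_right m n)) hn⟩
  refine ⟨isLowerSet_iUnion fun n => isLowerSet_tripleSet _, fun p hp =>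
    Set.mem_iUnion.2 ⟨0, hM.nablaSet_subset_tripleSet _ hp⟩, fun u₀ u₁ v h₀ h₁ => ?_,
    fun u v₀ v₁ h₀ h₁ => ?_⟩
  · obtain ⟨n, h₀, h₁⟩ := key h₀ h₁
    refine Set.mem_iUnion.2 ⟨n + 1, ?_⟩
    rw [Function.iterate_succ_apply']
    exact hM.sup_left_mem_tripleSet h₀ h₁
  · obtain ⟨n, h₀, h₁⟩ := key h₀ h₁
    exact Set.mem_iUnion.2 ⟨n, sup_right_mem_tripleSet h₀ h₁⟩

theorem IsM3.adjT_mem (hM : IsM3 M a b c) {I : Set (M × β)} (hI : IsBiIdeal I)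
    {x y z : β} (hx : (a, x) ∈ I) (hy : (b, y) ∈ I) (hz : (c, z) ∈ I) :
    (a, x ⊔ y ⊓ z) ∈ I := by
  obtain ⟨-, -, -, -, -, -, -, -, -, -, -, -, -, -, -, -, hbc⟩ := hM
  obtain ⟨hlow, -, hleft, hright⟩ := hI
  have h := hleft b c (y ⊓ z)
    (hlow (show (b, y ⊓ z) ≤ (b, y) from ⟨le_rfl, inf_le_left⟩) hy)
    (hlow (show (c, y ⊓ z) ≤ (c, z) from ⟨le_rfl, inf_le_right⟩) hz)
  rw [hbc] at h
  exact hright _ _ _ hx (hlow (show (a, y ⊓ z) ≤ (⊤, y ⊓ z) from ⟨le_top, le_rfl⟩) h)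

theorem IsM3.adjT_iterate_mem (hM : IsM3 M a b c) {I : Set (M × β)} (hI : IsBiIdeal I)
    {t : β × β × β} (hx : (a, t.1) ∈ I) (hy : (b, t.2.1) ∈ I) (hz : (c, t.2.2) ∈ I) (n : ℕ) :
    (a, (adjT^[n] t).1) ∈ I ∧ (b, (adjT^[n] t).2.1) ∈ I ∧ (c, (adjT^[n] t).2.2) ∈ I := by
  induction n with
  | zero => exact ⟨hx, hy, hz⟩
  | succ n ih =>
    obtain ⟨hx, hy, hz⟩ := ih
    rw [Function.iterate_succ_apply']
    refine ⟨hM.adjT_mem hI hx hy hz, ?_, hM.rotate.rotate.adjT_mem hI hz hx hy⟩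
    rw [adjT, inf_comm (adjT^[n] t).1]
    exact hM.rotate.adjT_mem hI hy hz hx

theorem IsM3.tripleSet_subset (hM : IsM3 M a b c) {I : Set (M × β)} (hI : IsBiIdeal I)
    {t : β × β × β} (hx : (a, t.1) ∈ I) (hy : (b, t.2.1) ∈ I) (hz : (c, t.2.2) ∈ I) :
    tripleSet β a b c t ⊆ I := by
  obtain ⟨hM, -, -, -, -, -, -, -, -, -, -, -, -, -, hab, -⟩ := hM
  obtain ⟨hlow, hbot, hleft, -⟩ := hI
  rintro ⟨u, v⟩ ⟨ha, hb, hc⟩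
  have mem : ∀ {d w}, (d, w) ∈ I → v ≤ w → (d, v) ∈ I := fun {d w} h hv =>
    hlow (show (d, v) ≤ (d, w) from ⟨le_rfl, hv⟩) h
  rcases hM u with rfl | rfl | rfl | rfl | rfl
  · exact hbot (Or.inl rfl)
  · exact mem hx (ha le_rfl)
  · exact mem hy (hb le_rfl)
  · exact mem hz (hc le_rfl)
  · rw [← hab]
    exact hleft _ _ _ (mem hx (ha le_top)) (mem hy (hb le_top))

theorem IsM3.inTensor_tripleSet (hM : IsM3 M a b c) {t : β × β × β} (ht : adjT t = t) :
    InTensor (tripleSet β a b c t) := by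
  classical
  refine ⟨{(a, t.1), (b, t.2.1), (c, t.2.2)}, Set.Subset.antisymm ?_ ?_⟩
  · exact hM.tripleSet_subset (isBiIdeal_biSpan _) (subset_biSpan _ (by simp))
      (subset_biSpan _ (by simp)) (subset_biSpan _ (by simp))
  · refine biSpan_subset (hM.isBiIdeal_tripleSet ht) ?_
    obtain ⟨hx, hy, hz⟩ := hM.mem_tripleSet t
    rintro p hp
    simp only [Finset.coe_insert, Finset.coe_singleton, Set.mem_insert_iff,
      Set.mem_singleton_iff] at hp
    rcases hp with rfl | rfl | rfl <;> assumption

theorem IsBiIdeal.finset_sup_mem {α : Type*} [Lattice α] [OrderBot α] {I : Set (α × β)}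
    (hI : IsBiIdeal I) (u : α) (s : Finset (α × β)) (h : ∀ p ∈ s, (u, p.2) ∈ I) :
    (u, s.sup Prod.snd) ∈ I := by
  classical
  induction s using Finset.induction_on with
  | empty => exact hI.2.1 (Or.inr rfl)
  | insert p s _ ih =>
    rw [Finset.sup_insert]
    exact hI.2.2.2 _ _ _ (h p (Finset.mem_insert_self p s))
      (ih fun q hq => h q (Finset.mem_insert_of_mem hq))

/-- Over an `n`-modular lattice, every element of the tensor product comes from a balanced
triple. -/
theorem IsM3.exists_tripleSet_eq (hM : IsM3 M a b c) {n : ℕ} (hn : NModular β n)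
    {I : Set (M × β)} (hI : InTensor I) :
    ∃ t : β × β × β, adjT t = t ∧ I = tripleSet β a b c t := by
  classical
  obtain ⟨s, rfl⟩ := hI
  change ∃ t : β × β × β, adjT t = t ∧ biSpan (s : Set (M × β)) = tripleSet β a b c t
  have hs := isBiIdeal_biSpan (s : Set (M × β))
  have mem : ∀ d : M, (d, (s.filter (d ≤ ·.1)).sup Prod.snd) ∈ biSpan (s : Set (M × β)) := by
    refine fun d => hs.finset_sup_mem _ _ fun p hp => ?_
    obtain ⟨hp, hd⟩ := Finset.mem_filter.1 hp
    exact hs.1 (show (d, p.2) ≤ p from ⟨hd, le_rfl⟩) (subset_biSpan _ hp)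
  set t : β × β × β := ((s.filter (a ≤ ·.1)).sup Prod.snd, (s.filter (b ≤ ·.1)).sup Prod.snd,
    (s.filter (c ≤ ·.1)).sup Prod.snd)
  refine ⟨adjT^[n] t, hn.adjT_iterate t, Set.Subset.antisymm ?_ ?_⟩
  · refine biSpan_subset (hM.isBiIdeal_tripleSet (hn.adjT_iterate t)) fun p hp =>
      tripleSet_mono (monotone_iterate_adjT t n.zero_le) ?_
    have le : ∀ d : M, d ≤ p.1 → p.2 ≤ (s.filter (d ≤ ·.1)).sup Prod.snd := fun d hd =>
      Finset.le_sup (f := Prod.snd) (Finset.mem_filter.2 ⟨hp, hd⟩)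
    exact ⟨le a, le b, le c⟩
  · obtain ⟨hx, hy, hz⟩ := hM.adjT_iterate_mem hs (t := t) (mem a) (mem b) (mem c) n
    exact hM.tripleSet_subset hs hx hy hz

theorem IsM3.exists_isGLB (hM : IsM3 M a b c) {n : ℕ} (hn : NModular β n)
    (I J : TensorProd M β) : ∃ K, IsGLB {I, J} K := by
  obtain ⟨s, hs, hI⟩ := hM.exists_tripleSet_eq hn I.2
  obtain ⟨t, ht, hJ⟩ := hM.exists_tripleSet_eq hn J.2
  refine ⟨⟨_, hM.inTensor_tripleSet (adjT_inf hs ht)⟩, ?_, fun K hK => ?_⟩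
  · rintro K (rfl | rfl)
    · exact (tripleSet_mono inf_le_left).trans hI.ge
    · exact (tripleSet_mono inf_le_right).trans hJ.ge
  · have hKI : (K : Set (M × β)) ⊆ I := hK (Set.mem_insert _ _)
    have hKJ : (K : Set (M × β)) ⊆ J := hK (Set.mem_insert_of_mem _ rfl)
    exact (Set.subset_inter (hKI.trans hI.le) (hKJ.trans hJ.le)).trans (tripleSet_inf s t).ge

/-- If meets exist in `M₃ ⊗ β`, then the first coordinates of the balancing sequence,
cut down by a fixed element, are eventually constant. -/
theorem IsM3.exists_forall_inf_le (hM : IsM3 M a b c)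
    (h : ∀ I J : TensorProd M β, ∃ K, IsGLB {I, J} K) (t : β × β × β) (w : β) :
    ∃ m, ∀ n, (adjT^[n] t).1 ⊓ w ≤ (adjT^[m] t).1 := by
  classical
  let s : Finset (M × β) := {(a, t.1), (b, t.2.1), (c, t.2.2)}
  have hs := isBiIdeal_biSpan (s : Set (M × β))
  have hst : biSpan (s : Set (M × β)) ⊆ ⋃ n : ℕ, tripleSet β a b c (adjT^[n] t) := by
    refine biSpan_subset (hM.isBiIdeal_iUnion_tripleSet t) fun p hp => Set.mem_iUnion.2 ⟨0, ?_⟩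
    obtain ⟨hx, hy, hz⟩ := hM.mem_tripleSet t
    simp only [s, Finset.coe_insert, Finset.coe_singleton, Set.mem_insert_iff,
      Set.mem_singleton_iff] at hp
    rcases hp with rfl | rfl | rfl <;> assumption
  obtain ⟨⟨K, g, rfl⟩, hlower, hgreatest⟩ :=
    h ⟨_, inTensor_biSpan s⟩ ⟨_, inTensor_pureTensor a w⟩
  have hKI : biSpan (g : Set (M × β)) ⊆ biSpan (s : Set (M × β)) :=
    hlower (Set.mem_insert _ _)
  have hKJ : biSpan (g : Set (M × β)) ⊆ pureTensor a w :=
    hlower (Set.mem_insert_of_mem _ rfl)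
  have hmem : ∀ p ∈ g, ∃ m : ℕ, p ∈ pureTensor a (adjT^[m] t).1 := by
    intro p hp
    have hpg := subset_biSpan (g : Set (M × β)) hp
    obtain ⟨m, hm⟩ := Set.mem_iUnion.1 (hst (hKI hpg))
    refine ⟨m, ?_⟩
    obtain h | h | ⟨h, -⟩ := hKJ hpg
    · exact Or.inl h
    · exact Or.inr (Or.inl h)
    · rcases hM.1 p.1 with hp | hp | hp | hp | hp
      · exact Or.inl hp
      · exact Or.inr (Or.inr ⟨h, hm.1 hp.ge⟩)
      · exact absurd (hp ▸ h) hM.rotate.not_le_right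
      · exact absurd (hp ▸ h) hM.rotate.rotate.not_le_left
      · exact Or.inr (Or.inr ⟨h, hm.1 (hp ▸ le_top)⟩)
  choose! f hf using hmem
  have hg : biSpan (g : Set (M × β)) ⊆ pureTensor a (adjT^[g.sup f] t).1 := by
    refine biSpan_subset (isBiIdeal_pureTensor _ _) fun p hp => ?_
    obtain h | h | h := hf p hp
    · exact Or.inl h
    · exact Or.inr (Or.inl h)
    · exact Or.inr (Or.inr ⟨h.1, h.2.trans (monotone_iterate_adjT t (Finset.le_sup hp)).1⟩)
  refine ⟨g.sup f, fun n => ?_⟩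
  have hle : (⟨_, inTensor_pureTensor a ((adjT^[n] t).1 ⊓ w)⟩ : TensorProd M β) ≤
      ⟨_, inTensor_biSpan g⟩ := by
    refine hgreatest ?_
    rintro K (rfl | rfl)
    · refine (pureTensor_subset_iff hs).2 (hs.1 (show (a, (adjT^[n] t).1 ⊓ w) ≤
        (a, (adjT^[n] t).1) from ⟨le_rfl, inf_le_left⟩) ?_)
      exact (hM.adjT_iterate_mem hs (subset_biSpan _ (by simp [s])) (subset_biSpan _ (by simp [s]))
        (subset_biSpan _ (by simp [s])) n).1
    · exact (pureTensor_subset_iff (isBiIdeal_pureTensor a w)).2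
        (Or.inr (Or.inr ⟨le_rfl, inf_le_right⟩))
  obtain h | h | h := hg (hle (mem_pureTensor_self _ _))
  · exact absurd (h.le.trans bot_le) hM.not_le_left
  · exact (show (adjT^[n] t).1 ⊓ w = ⊥ from h).le.trans bot_le
  · exact h.2

end M3

/-- Let `L` be a lattice with zero and let `L^ω` be the lattice of sequences `ℕ → L`
with componentwise operations.  Then `M₃ ⊗ L^ω` is a lattice iff `L` is `n`-modular
for some `n > 0`. -/
theorem stmt14 {M : Type*} [Lattice M] [BoundedOrder M] {a b c : M}
    (hM : IsM3 M a b c) {α : Type*} [Lattice α] [OrderBot α] :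
    ((∀ I J : TensorProd M (ℕ → α), ∃ K, IsLUB {I, J} K) ∧
     (∀ I J : TensorProd M (ℕ → α), ∃ K, IsGLB {I, J} K)) ↔
    (∃ n : ℕ, 0 < n ∧ NModular α n) := by
  constructor
  · rintro ⟨-, h⟩
    by_contra! hn
    have hfail : ∀ n, ∃ t : α × α × α, (adjT^[n + 1] t).1 ≠ (adjT^[n + 2] t).1 := fun n => by
      simpa [NModular] using hn (n + 1) n.succ_pos
    choose f hf using hfail
    obtain ⟨m, hm⟩ := hM.exists_forall_inf_le h
      (fun n => (f n).1, fun n => (f n).2.1, fun n => (f n).2.2)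
      (fun n => (adjT^[n + 2] (f n)).1)
    have hle := hm (m + 2) m
    have happ := fun k => congrArg Prod.fst (adjT_iterate_apply
      ((fun n => (f n).1, fun n => (f n).2.1, fun n => (f n).2.2) :
        (ℕ → α) × (ℕ → α) × (ℕ → α)) k m)
    simp only [Prod.mk.eta] at happ
    rw [Pi.inf_apply, ← happ, ← happ, inf_idem] at hle
    exact hf m (le_antisymm (monotone_iterate_adjT _ (by omega)).1
      (hle.trans (monotone_iterate_adjT _ (by omega : m ≤ m + 1)).1))
  · rintro ⟨n, -, hn⟩
    exact ⟨TensorProd.exists_isLUB, hM.exists_isGLB hn.pi⟩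
end

section
/- Let n > 0 and let L be an n-modular lattice. Then the ideal lattice Id(M₃[L]) of the lattice M₃[L] is isomorphic to M₃[Id L], the lattice of balanced triples of ideals of L, i.e., triples (I, J, K) of ideals of L with I ∩ J = I ∩ K = J ∩ K, ordered componentwise by inclusion. -/
/-- A triple `(x, y, z)` in a lattice is *balanced* if `x ⊓ y = x ⊓ z = y ⊓ z`. -/
def IsBalanced {α : Type*} [Lattice α] (t : α × α × α) : Prop :=
  t.1 ⊓ t.2.1 = t.1 ⊓ t.2.2 ∧ t.1 ⊓ t.2.2 = t.2.1 ⊓ t.2.2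

theorem isBalanced_iff {α : Type*} [Lattice α] {t : α × α × α} :
    IsBalanced t ↔ t.2.1 ⊓ t.2.2 ≤ t.1 ∧ t.1 ⊓ t.2.2 ≤ t.2.1 ∧ t.1 ⊓ t.2.1 ≤ t.2.2 := by
  obtain ⟨x, y, z⟩ := t
  constructor
  · rintro ⟨h₁, h₂⟩
    dsimp only at *
    exact ⟨h₂ ▸ inf_le_left, h₁ ▸ inf_le_right, h₁ ▸ inf_le_right⟩
  · rintro ⟨hx, hy, hz⟩
    exact ⟨le_antisymm (le_inf inf_le_left hz) (le_inf inf_le_left hy),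
      le_antisymm (le_inf hy inf_le_right) (le_inf hx inf_le_right)⟩

theorem isBalanced_of_adjT_eq {α : Type*} [Lattice α] {t : α × α × α} (h : adjT t = t) :
    IsBalanced t := by
  rw [isBalanced_iff]
  simpa [adjT, Prod.ext_iff] using h

theorem le_adjT_iterate {α : Type*} [Lattice α] (t : α × α × α) (n : ℕ) : t ≤ adjT^[n] t :=
  Function.id_le_iterate_of_id_le
    (fun _ => Prod.mk_le_mk.2 ⟨le_sup_left, Prod.mk_le_mk.2 ⟨le_sup_left, le_sup_left⟩⟩) n t

/-- `adjT` commutes with exchanging the first two coordinates. -/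
theorem adjT_semiconj_swap₁₂ {α : Type*} [Lattice α] :
    Function.Semiconj (fun t : α × α × α => (t.2.1, t.1, t.2.2)) adjT adjT :=
  fun t => by simp [adjT, inf_comm]

/-- `adjT` commutes with exchanging the first and the third coordinate. -/
theorem adjT_semiconj_swap₁₃ {α : Type*} [Lattice α] :
    Function.Semiconj (fun t : α × α × α => (t.2.2, t.2.1, t.1)) adjT adjT :=
  fun t => by simp [adjT, inf_comm]

theorem NModular.isBalanced_adjT_iterate {α : Type*} [Lattice α] {n : ℕ} (h : NModular α n)
    (t : α × α × α) : IsBalanced (adjT^[n] t) := by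
  apply isBalanced_of_adjT_eq
  rw [← Function.iterate_succ_apply' adjT]
  refine Prod.ext (h t).symm (Prod.ext ?_ ?_)
  · have := h (t.2.1, t.1, t.2.2)
    rw [← (adjT_semiconj_swap₁₂.iterate_right n).eq t,
      ← (adjT_semiconj_swap₁₂.iterate_right (n + 1)).eq t] at this
    exact this.symm
  · have := h (t.2.2, t.2.1, t.1)
    rw [← (adjT_semiconj_swap₁₃.iterate_right n).eq t,
      ← (adjT_semiconj_swap₁₃.iterate_right (n + 1)).eq t] at this
    exact this.symm

namespace Order.Ideal

/-- The ideal generated by the image of an ideal under a monotone map. -/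
def mapMonotone {P Q : Type*} [Preorder P] [Preorder Q] (f : P → Q) (hf : Monotone f)
    (I : Ideal P) : Ideal Q where
  carrier := {x | ∃ t ∈ I, x ≤ f t}
  lower' := fun _ _ hba ⟨t, ht, hat⟩ => ⟨t, ht, hba.trans hat⟩
  nonempty' := I.nonempty.imp' f fun t ht => ⟨t, ht, le_rfl⟩
  directed' := by
    rintro a ⟨s, hs, has⟩ b ⟨t, ht, hbt⟩
    obtain ⟨u, hu, hsu, htu⟩ := I.directed s hs t ht
    exact ⟨f u, ⟨u, hu, le_rfl⟩, has.trans (hf hsu), hbt.trans (hf htu)⟩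

theorem mapMonotone_mono {P Q : Type*} [Preorder P] [Preorder Q] {f : P → Q} (hf : Monotone f) :
    Monotone (mapMonotone f hf) :=
  fun _ _ hIJ _ ⟨t, ht, hxt⟩ => ⟨t, hIJ ht, hxt⟩

end Order.Ideal

/-- The condition of being balanced for a triple of ideals, in terms of their carriers. -/
abbrev IsBalancedIdeals {α : Type*} [Lattice α]
    (T : Order.Ideal α × Order.Ideal α × Order.Ideal α) : Prop :=
  (T.1 : Set α) ∩ (T.2.1 : Set α) = (T.1 : Set α) ∩ (T.2.2 : Set α) ∧
    (T.1 : Set α) ∩ (T.2.2 : Set α) = (T.2.1 : Set α) ∩ (T.2.2 : Set α)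

theorem isBalancedIdeals_iff {α : Type*} [Lattice α]
    {T : Order.Ideal α × Order.Ideal α × Order.Ideal α} :
    IsBalancedIdeals T ↔ ∀ a, (a ∈ T.2.1 → a ∈ T.2.2 → a ∈ T.1) ∧
      (a ∈ T.1 → a ∈ T.2.2 → a ∈ T.2.1) ∧ (a ∈ T.1 → a ∈ T.2.1 → a ∈ T.2.2) := by
  simp only [IsBalancedIdeals, Set.ext_iff, ← forall_and, Set.mem_inter_iff, SetLike.mem_coe]
  exact forall_congr' fun a => by tauto

namespace BalancedTriple

variable {α : Type*} [Lattice α]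

/-- The triple of coordinate projections of an ideal of balanced triples. -/
def projIdeals (I : Order.Ideal {t : α × α × α // IsBalanced t}) :
    Order.Ideal α × Order.Ideal α × Order.Ideal α :=
  (I.mapMonotone (fun t => t.1.1) (monotone_fst.comp (Subtype.mono_coe _)),
    I.mapMonotone (fun t => t.1.2.1)
      (monotone_fst.comp (monotone_snd.comp (Subtype.mono_coe _))),
    I.mapMonotone (fun t => t.1.2.2)
      (monotone_snd.comp (monotone_snd.comp (Subtype.mono_coe _))))

theorem projIdeals_mono : Monotone (projIdeals (α := α)) := fun _ _ h =>
  ⟨Order.Ideal.mapMonotone_mono (monotone_fst.comp (Subtype.mono_coe _)) h,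
    Order.Ideal.mapMonotone_mono (monotone_fst.comp (monotone_snd.comp (Subtype.mono_coe _))) h,
    Order.Ideal.mapMonotone_mono (monotone_snd.comp (monotone_snd.comp (Subtype.mono_coe _))) h⟩

theorem isBalancedIdeals_projIdeals (I : Order.Ideal {t : α × α × α // IsBalanced t}) :
    IsBalancedIdeals (projIdeals I) := by
  rw [isBalancedIdeals_iff]
  refine fun a => ⟨?_, ?_, ?_⟩ <;>
    rintro ⟨s, hs, has⟩ ⟨t, ht, hat⟩ <;>
    obtain ⟨u, hu, hsu, htu⟩ := I.directed s hs t ht <;>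
    refine ⟨u, hu, ?_⟩
  · exact (le_inf (has.trans hsu.2.1) (hat.trans htu.2.2)).trans (isBalanced_iff.1 u.2).1
  · exact (le_inf (has.trans hsu.1) (hat.trans htu.2.2)).trans (isBalanced_iff.1 u.2).2.1
  · exact (le_inf (has.trans hsu.1) (hat.trans htu.2.1)).trans (isBalanced_iff.1 u.2).2.2

theorem mem_of_mem_projIdeals {I : Order.Ideal {t : α × α × α // IsBalanced t}}
    {t : {t : α × α × α // IsBalanced t}} (h₁ : t.1.1 ∈ (projIdeals I).1)
    (h₂ : t.1.2.1 ∈ (projIdeals I).2.1) (h₃ : t.1.2.2 ∈ (projIdeals I).2.2) : t ∈ I := by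
  obtain ⟨a, ha, hta⟩ := h₁
  obtain ⟨b, hb, htb⟩ := h₂
  obtain ⟨c, hc, htc⟩ := h₃
  obtain ⟨d, hd, had, hbd⟩ := I.directed a ha b hb
  obtain ⟨e, he, hde, hce⟩ := I.directed d hd c hc
  exact I.lower (show t ≤ e from ⟨hta.trans (had.trans hde).1, htb.trans (hbd.trans hde).2.1,
    htc.trans hce.2.2⟩) he

theorem exists_mem_of_triple (T : Order.Ideal α × Order.Ideal α × Order.Ideal α) :
    ∃ d, d ∈ T.1 ∧ d ∈ T.2.1 ∧ d ∈ T.2.2 := by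
  obtain ⟨a, ha⟩ := T.1.nonempty
  obtain ⟨b, hb⟩ := T.2.1.nonempty
  obtain ⟨c, hc⟩ := T.2.2.nonempty
  exact ⟨a ⊓ b ⊓ c, T.1.lower (inf_le_left.trans inf_le_left) ha,
    T.2.1.lower (inf_le_left.trans inf_le_right) hb, T.2.2.lower inf_le_right hc⟩

theorem adjT_iterate_mem {T : Order.Ideal α × Order.Ideal α × Order.Ideal α}
    (hT : IsBalancedIdeals T) {t : α × α × α}
    (ht : t.1 ∈ T.1 ∧ t.2.1 ∈ T.2.1 ∧ t.2.2 ∈ T.2.2) (n : ℕ) :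
    (adjT^[n] t).1 ∈ T.1 ∧ (adjT^[n] t).2.1 ∈ T.2.1 ∧ (adjT^[n] t).2.2 ∈ T.2.2 := by
  rw [isBalancedIdeals_iff] at hT
  induction n generalizing t with
  | zero => exact ht
  | succ n ih =>
    obtain ⟨h₁, h₂, h₃⟩ := ht
    exact ih ⟨
      Order.Ideal.sup_mem h₁ ((hT _).1 (T.2.1.lower inf_le_left h₂) (T.2.2.lower inf_le_right h₃)),
      Order.Ideal.sup_mem h₂ ((hT _).2.1 (T.1.lower inf_le_left h₁) (T.2.2.lower inf_le_right h₃)),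
      Order.Ideal.sup_mem h₃ ((hT _).2.2 (T.1.lower inf_le_left h₁) (T.2.1.lower inf_le_right h₂))⟩

/-- The ideal of all balanced triples whose coordinates lie in the members of a balanced triple
of ideals of an `n`-modular lattice. -/
def boxIdeal {n : ℕ} (h : NModular α n)
    (T : Order.Ideal α × Order.Ideal α × Order.Ideal α) (hT : IsBalancedIdeals T) :
    Order.Ideal {t : α × α × α // IsBalanced t} where
  carrier := {t | t.1.1 ∈ T.1 ∧ t.1.2.1 ∈ T.2.1 ∧ t.1.2.2 ∈ T.2.2}
  lower' := fun _ _ hba ⟨h₁, h₂, h₃⟩ =>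
    ⟨T.1.lower hba.1 h₁, T.2.1.lower hba.2.1 h₂, T.2.2.lower hba.2.2 h₃⟩
  nonempty' := by
    obtain ⟨d, hd⟩ := exists_mem_of_triple T
    exact ⟨⟨(d, d, d), rfl, rfl⟩, hd⟩
  directed' := fun s ⟨hs₁, hs₂, hs₃⟩ t ⟨ht₁, ht₂, ht₃⟩ =>
    ⟨⟨adjT^[n] (s.1 ⊔ t.1), h.isBalanced_adjT_iterate _⟩,
      adjT_iterate_mem hT
        ⟨Order.Ideal.sup_mem hs₁ ht₁, Order.Ideal.sup_mem hs₂ ht₂, Order.Ideal.sup_mem hs₃ ht₃⟩ n,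
      (le_sup_left : s.1 ≤ s.1 ⊔ t.1).trans (le_adjT_iterate _ n),
      (le_sup_right : t.1 ≤ s.1 ⊔ t.1).trans (le_adjT_iterate _ n)⟩

theorem projIdeals_boxIdeal {n : ℕ} (h : NModular α n)
    (T : Order.Ideal α × Order.Ideal α × Order.Ideal α) (hT : IsBalancedIdeals T) :
    projIdeals (boxIdeal h T hT) = T := by
  obtain ⟨d, hd₁, hd₂, hd₃⟩ := exists_mem_of_triple T
  refine Prod.ext (Order.Ideal.ext ?_) (Prod.ext (Order.Ideal.ext ?_) (Order.Ideal.ext ?_)) <;>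
    refine Set.ext fun x => ⟨?_, fun hx => ?_⟩
  · rintro ⟨t, ht, hxt⟩
    exact T.1.lower hxt ht.1
  · exact ⟨⟨(x, x ⊓ d, x ⊓ d), by simp [IsBalanced]⟩,
      ⟨hx, T.2.1.lower inf_le_right hd₂, T.2.2.lower inf_le_right hd₃⟩, le_rfl⟩
  · rintro ⟨t, ht, hxt⟩
    exact T.2.1.lower hxt ht.2.1
  · exact ⟨⟨(x ⊓ d, x, x ⊓ d), by simp [IsBalanced]⟩,
      ⟨T.1.lower inf_le_right hd₁, hx, T.2.2.lower inf_le_right hd₃⟩, le_rfl⟩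
  · rintro ⟨t, ht, hxt⟩
    exact T.2.2.lower hxt ht.2.2
  · exact ⟨⟨(x ⊓ d, x ⊓ d, x), by simp [IsBalanced]⟩,
      ⟨T.1.lower inf_le_right hd₁, T.2.1.lower inf_le_right hd₂, hx⟩, le_rfl⟩

theorem boxIdeal_projIdeals {n : ℕ} (h : NModular α n)
    (I : Order.Ideal {t : α × α × α // IsBalanced t}) :
    boxIdeal h (projIdeals I) (isBalancedIdeals_projIdeals I) = I :=
  Order.Ideal.ext <| Set.ext fun t =>
    ⟨fun ⟨h₁, h₂, h₃⟩ => mem_of_mem_projIdeals h₁ h₂ h₃,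
      fun ht => ⟨⟨t, ht, le_rfl⟩, ⟨t, ht, le_rfl⟩, ⟨t, ht, le_rfl⟩⟩⟩

/-- Ideals of balanced triples correspond to balanced triples of ideals. -/
def idealOrderIso {n : ℕ} (h : NModular α n) :
    Order.Ideal {t : α × α × α // IsBalanced t} ≃o
      {T : Order.Ideal α × Order.Ideal α × Order.Ideal α // IsBalancedIdeals T} :=
  Equiv.toOrderIso
    { toFun := fun I => ⟨projIdeals I, isBalancedIdeals_projIdeals I⟩
      invFun := fun T => boxIdeal h T.1 T.2
      left_inv := boxIdeal_projIdeals h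
      right_inv := fun T => Subtype.ext (projIdeals_boxIdeal h T.1 T.2) }
    (fun _ _ hIJ => projIdeals_mono hIJ)
    (fun S T (hST : S.1 ≤ T.1) t
      (ht : t.1.1 ∈ S.1.1 ∧ t.1.2.1 ∈ S.1.2.1 ∧ t.1.2.2 ∈ S.1.2.2) =>
      ⟨hST.1 ht.1, hST.2.1 ht.2.1, hST.2.2 ht.2.2⟩)

end BalancedTriple

/-- Let `n > 0` and let `L` be an `n`-modular lattice.  Then the ideal lattice
`Id(M₃[L])` is isomorphic to `M₃[Id L]`, the lattice of balanced triples `(I, J, K)` of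
ideals of `L` (i.e., with `I ∩ J = I ∩ K = J ∩ K`), ordered componentwise by inclusion. -/
theorem stmt15 {α : Type*} [Lattice α] (n : ℕ) (hn : 0 < n) (h : NModular α n) :
    Nonempty (Order.Ideal {t : α × α × α // IsBalanced t} ≃o
      {T : Order.Ideal α × Order.Ideal α × Order.Ideal α //
        (T.1 : Set α) ∩ (T.2.1 : Set α) = (T.1 : Set α) ∩ (T.2.2 : Set α) ∧
        (T.1 : Set α) ∩ (T.2.2 : Set α) = (T.2.1 : Set α) ∩ (T.2.2 : Set α)}) := by
  exact ⟨BalancedTriple.idealOrderIso h⟩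
end

section
/- Let V be an infinite-dimensional vector space over a field K and let L(V) be its (modular) lattice of subspaces. Then the lattice M₃[L(V)] of balanced triples of subspaces is not n-modular for any n > 0; that is, there exists a modular lattice M such that M₃[M] has modularity rank ∞. -/
/-- One step of the balancing sequence of a triple, relative to given binary operations
`sup` and `inf`: `(x, y, z) ↦ (x ⊔ (y ⊓ z), y ⊔ (x ⊓ z), z ⊔ (x ⊓ y))`. -/
def pqrGen {β : Type*} (sup inf : β → β → β) (t : β × β × β) : β × β × β :=
  (sup t.1 (inf t.2.1 t.2.2), sup t.2.1 (inf t.1 t.2.2), sup t.2.2 (inf t.1 t.2.1))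

theorem IsBalanced.inf {α : Type*} [Lattice α] {s t : α × α × α}
    (hs : IsBalanced s) (ht : IsBalanced t) : IsBalanced (s ⊓ t) := by
  obtain ⟨h₁, h₂⟩ := hs
  obtain ⟨h₃, h₄⟩ := ht
  constructor <;> simp only [Prod.fst_inf, Prod.snd_inf]
  · rw [inf_inf_inf_comm, h₁, h₃, inf_inf_inf_comm]
  · rw [inf_inf_inf_comm, h₂, h₄, inf_inf_inf_comm]

theorem IsBalanced.iInf {α ι : Type*} [CompleteLattice α] {t : ι → α × α × α}
    (ht : ∀ i, IsBalanced (t i)) : IsBalanced (⨅ i, t i) := by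
  constructor <;>
    simp only [Prod.fst_iInf, Prod.snd_iInf, ← iInf_inf_eq, (ht _).1, (ht _).2]

/-- The balanced triples of a complete lattice have pairwise joins. -/
theorem exists_isLUB_pair_balanced {α : Type*} [CompleteLattice α]
    (a b : {t : α × α × α // IsBalanced t}) : ∃ s, IsLUB {a, b} s := by
  refine ⟨⟨⨅ t : {t // a ≤ t ∧ b ≤ t}, t.1.1,
    IsBalanced.iInf fun t => t.1.2⟩, ?_, ?_⟩
  · rintro c (rfl | rfl)
    · exact le_iInf (f := fun t : {t // c ≤ t ∧ b ≤ t} => t.1.1)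
        fun t => t.2.1
    · exact le_iInf (f := fun t : {t // a ≤ t ∧ c ≤ t} => t.1.1)
        fun t => t.2.2
  · intro c hc
    exact iInf_le (fun t : {t // a ≤ t ∧ b ≤ t} => t.1.1)
      ⟨c, hc (by simp), hc (by simp)⟩

theorem isGLB_pair_balanced {α : Type*} [Lattice α]
    (a b : {t : α × α × α // IsBalanced t}) :
    IsGLB {a, b} ⟨a.1 ⊓ b.1, a.2.inf b.2⟩ := by
  constructor
  · rintro c (rfl | rfl)
    · exact inf_le_left (a := c.1) (b := b.1)
    · exact inf_le_right (a := a.1) (b := c.1)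
  · intro c hc
    exact le_inf (α := α × α × α) (hc (by simp : a ∈ _)) (hc (by simp : b ∈ _))

/-- If the first component of the balancing sequence is stationary from `n` to `n + 1` for every
starting triple, then so is the whole triple. -/
theorem iterate_pqrGen_eq_of_fst_eq {β : Type*} {sup inf : β → β → β}
    (hcomm : ∀ a b, inf a b = inf b a) {n : ℕ}
    (h : ∀ t, ((pqrGen sup inf)^[n] t).1 = ((pqrGen sup inf)^[n + 1] t).1) (t : β × β × β) :
    (pqrGen sup inf)^[n] t = (pqrGen sup inf)^[n + 1] t := by
  have h₁ : Function.Commute (pqrGen sup inf) fun t => (t.2.1, t.1, t.2.2) := fun t => by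
    simp [pqrGen, hcomm t.1 t.2.1]
  have h₂ : Function.Commute (pqrGen sup inf) fun t => (t.2.2, t.2.1, t.1) := fun t => by
    simp [pqrGen, hcomm t.1 t.2.1, hcomm t.1 t.2.2, hcomm t.2.1 t.2.2]
  refine Prod.ext (h t) (Prod.ext ?_ ?_)
  · have := h (t.2.1, t.1, t.2.2)
    rwa [(h₁.iterate_left n) t, (h₁.iterate_left (n + 1)) t] at this
  · have := h (t.2.2, t.2.1, t.1)
    rwa [(h₂.iterate_left n) t, (h₂.iterate_left (n + 1)) t] at this

section Grid

variable {K V : Type*} [Field K] [AddCommGroup V] [Module K V]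

/-- The vectors whose coordinates `w i m` vanish for all `i ∉ S`. -/
def supportedSpace (w : Fin 4 → ℕ → V →ₗ[K] K) (S : Set (Fin 4)) : Submodule K V where
  carrier := {v | ∀ i ∉ S, ∀ m, w i m v = 0}
  zero_mem' := by simp
  add_mem' := by
    intro a b ha hb i hi m
    rw [map_add, ha i hi m, hb i hi m, add_zero]
  smul_mem' := by
    intro c a ha i hi m
    rw [map_smul, ha i hi m, smul_zero]

/-- The vectors supported on the blocks `i` and `j` whose coordinates `w i (m + s)` and `w j m`
agree for all `m ≥ k`. -/
def eventualGraph (w : Fin 4 → ℕ → V →ₗ[K] K) (i j : Fin 4) (s k : ℕ) : Submodule K V :=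
  supportedSpace w {i, j} ⊓
    { carrier := {v | ∀ m, k ≤ m → w i (m + s) v = w j m v}
      zero_mem' := by simp
      add_mem' := by
        intro a b ha hb m hm
        rw [map_add, map_add, ha m hm, hb m hm]
      smul_mem' := by
        intro c a ha m hm
        rw [map_smul, map_smul, ha m hm] }

theorem mem_supportedSpace {w : Fin 4 → ℕ → V →ₗ[K] K} {S : Set (Fin 4)} {v : V} :
    v ∈ supportedSpace w S ↔ ∀ i ∉ S, ∀ m, w i m v = 0 := Iff.rfl

theorem mem_eventualGraph {w : Fin 4 → ℕ → V →ₗ[K] K} {i j : Fin 4} {s k : ℕ} {v : V} :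
    v ∈ eventualGraph w i j s k ↔
      (∀ l ∉ ({i, j} : Set (Fin 4)), ∀ m, w l m v = 0) ∧
        ∀ m, k ≤ m → w i (m + s) v = w j m v := Iff.rfl

/-- First row of the `k`-th grid bounding the balancing sequence. -/
def gridP (w : Fin 4 → ℕ → V →ₗ[K] K) (k : ℕ) :
    {t : Submodule K V × Submodule K V × Submodule K V // IsBalanced t} :=
  ⟨(eventualGraph w 0 1 0 (k + 1), eventualGraph w 0 3 1 k, supportedSpace w {0}), by
    have shift (v : V) : (∀ m, k < m → w 0 m v = w 1 m v) ↔
        ∀ m, k ≤ m → w 0 (m + 1) v = w 1 (m + 1) v :=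
      ⟨fun h m hm => h _ (by lia), fun h m hm => by
        simpa [Nat.sub_add_cancel (by lia : 1 ≤ m)] using h (m - 1) (by lia)⟩
    constructor <;> ext v <;>
      simp [shift, mem_eventualGraph, mem_supportedSpace, Fin.forall_fin_succ] <;> grind⟩

/-- Second row of the `k`-th grid bounding the balancing sequence. -/
def gridQ (w : Fin 4 → ℕ → V →ₗ[K] K) (k : ℕ) :
    {t : Submodule K V × Submodule K V × Submodule K V // IsBalanced t} :=
  ⟨(eventualGraph w 1 2 0 k, eventualGraph w 2 3 0 k, supportedSpace w {2}), by
    constructor <;> ext v <;>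
      simp [mem_eventualGraph, mem_supportedSpace, Fin.forall_fin_succ] <;> grind⟩

/-- Third row of the grids bounding the balancing sequence. -/
def gridR (w : Fin 4 → ℕ → V →ₗ[K] K) :
    {t : Submodule K V × Submodule K V × Submodule K V // IsBalanced t} :=
  ⟨(supportedSpace w {1}, supportedSpace w {3}, supportedSpace w ∅), by
    constructor <;> ext v <;>
      simp [mem_supportedSpace, Fin.forall_fin_succ] <;> grind⟩

theorem inf_gridQ_gridR_le (w : Fin 4 → ℕ → V →ₗ[K] K) (k : ℕ) :
    (gridQ w k).1 ⊓ (gridR w).1 ≤ (gridP w (k + 1)).1 := by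
  refine ⟨fun v => ?_, fun v => ?_, fun v => ?_⟩ <;>
    simp [gridP, gridQ, gridR, mem_eventualGraph, mem_supportedSpace, Fin.forall_fin_succ] <;>
    grind

theorem inf_gridP_gridR_le (w : Fin 4 → ℕ → V →ₗ[K] K) (k : ℕ) :
    (gridP w k).1 ⊓ (gridR w).1 ≤ (gridQ w (k + 1)).1 := by
  refine ⟨fun v => ?_, fun v => ?_, fun v => ?_⟩ <;>
    simp [gridP, gridQ, gridR, mem_eventualGraph, mem_supportedSpace, Fin.forall_fin_succ] <;>
    grind

theorem inf_gridP_gridQ_le (w : Fin 4 → ℕ → V →ₗ[K] K) (k : ℕ) :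
    (gridP w k).1 ⊓ (gridQ w k).1 ≤ (gridR w).1 := by
  refine ⟨fun v => ?_, fun v => ?_, fun v => ?_⟩ <;>
    simp [gridP, gridQ, gridR, mem_eventualGraph, mem_supportedSpace, Fin.forall_fin_succ] <;>
    grind

theorem gridP_le_succ (w : Fin 4 → ℕ → V →ₗ[K] K) (k : ℕ) : gridP w k ≤ gridP w (k + 1) :=
  ⟨fun _ hv => ⟨hv.1, fun m hm => hv.2 m (by lia)⟩,
    fun _ hv => ⟨hv.1, fun m hm => hv.2 m (by lia)⟩, le_rfl⟩

theorem gridQ_le_succ (w : Fin 4 → ℕ → V →ₗ[K] K) (k : ℕ) : gridQ w k ≤ gridQ w (k + 1) :=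
  ⟨fun _ hv => ⟨hv.1, fun m hm => hv.2 m (by lia)⟩,
    fun _ hv => ⟨hv.1, fun m hm => hv.2 m (by lia)⟩, le_rfl⟩

/-- An infinite-dimensional space carries a biorthogonal system indexed by `Fin 4 × ℕ`. -/
theorem exists_biorthogonal (hV : ¬ FiniteDimensional K V) :
    ∃ (w : Fin 4 → ℕ → V →ₗ[K] K) (e : Fin 4 → ℕ → V),
      ∀ i m j l, w i m (e j l) = if j = i ∧ l = m then 1 else 0 := by
  let b := Module.Basis.ofVectorSpace K V
  have : Infinite (Module.Basis.ofVectorSpaceIndex K V) := by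
    by_contra h
    rw [not_infinite_iff_finite] at h
    exact hV (Module.Finite.of_basis b)
  let f : Fin 4 × ℕ ↪ Module.Basis.ofVectorSpaceIndex K V :=
    (Encodable.encode' (Fin 4 × ℕ)).trans (Infinite.natEmbedding _)
  refine ⟨fun i m => b.coord (f (i, m)), fun j l => b (f (j, l)), fun i m j l => ?_⟩
  classical
  simp [Finsupp.single_apply]

/-- A balanced grid that contains the initial grid and is also closed under the column meets
contains all the vectors `e 0 m` in its first cell. -/
theorem mem_of_grid_closed {w : Fin 4 → ℕ → V →ₗ[K] K} {e : Fin 4 → ℕ → V}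
    (he : ∀ i m j l, w i m (e j l) = if j = i ∧ l = m then 1 else 0)
    {x y z : {t : Submodule K V × Submodule K V × Submodule K V // IsBalanced t}}
    (hx : gridP w 0 ≤ x) (hy : gridQ w 0 ≤ y) (hz : gridR w ≤ z)
    (hyz : y.1 ⊓ z.1 ≤ x.1) (hxz : x.1 ⊓ z.1 ≤ y.1) (m : ℕ) : e 0 m ∈ x.1.1 := by
  induction m with
  | zero =>
    refine hx.1 ?_
    simp [gridP, mem_eventualGraph, Fin.forall_fin_succ, he]
    lia
  | succ m ih =>
    have add_mem_iff' {S : Submodule K V} {u v : V} (huv : u + v ∈ S) (hu : u ∈ S) : v ∈ S :=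
      (S.add_mem_iff_right hu).1 huv
    have h₁ : e 1 m ∈ x.1.1 := add_mem_iff' (hx.1 (by
      simp [gridP, mem_eventualGraph, Fin.forall_fin_succ, he])) ih
    have h₂ : e 1 m ∈ y.1.1 := hxz.1 ⟨h₁, hz.1 (by
      simp [gridR, mem_supportedSpace, Fin.forall_fin_succ, he])⟩
    have h₃ : e 2 m ∈ y.1.1 := add_mem_iff' (hy.1 (by
      simp [gridQ, mem_eventualGraph, Fin.forall_fin_succ, he])) h₂
    have h₄ : e 2 m ∈ y.1.1 ⊓ y.1.2.2 := ⟨h₃, hy.2.2 (by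
      simp [gridQ, mem_supportedSpace, Fin.forall_fin_succ, he])⟩
    rw [y.2.2] at h₄
    have h₅ : e 3 m ∈ y.1.2.1 := add_mem_iff' (hy.2.1 (by
      simp [gridQ, mem_eventualGraph, Fin.forall_fin_succ, he])) h₄.1
    have h₆ : e 3 m ∈ x.1.2.1 := hyz.2.1 ⟨h₅, hz.2.1 (by
      simp [gridR, mem_supportedSpace, Fin.forall_fin_succ, he])⟩
    have h₇ : e 0 (m + 1) ∈ x.1.2.1 := add_mem_iff' (hx.2.1 (by
      simp [gridP, mem_eventualGraph, Fin.forall_fin_succ, he])) h₆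
    have h₈ : e 0 (m + 1) ∈ x.1.2.1 ⊓ x.1.2.2 := ⟨h₇, hx.2.2 (by
      simp [gridP, mem_supportedSpace, Fin.forall_fin_succ, he])⟩
    rw [← x.2.2] at h₈
    exact h₈.1

end Grid

/-- Let `V` be an infinite-dimensional vector space over a field `K`, and let `L(V)` be its
(modular) lattice of subspaces.  Then `M₃[L(V)]`, the poset of balanced triples of
subspaces, is a lattice (pairwise joins exist; meets are componentwise), but — for any
operations `sup`, `inf` realizing its joins and meets — it fails the identity `γₙ` for
every `n > 0`: `M₃[L(V)]` is not `n`-modular for any `n > 0`.  Thus there is a modular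
lattice `M` such that `M₃[M]` has modularity rank `∞`. -/
theorem stmt17 {K V : Type*} [Field K] [AddCommGroup V] [Module K V]
    (hV : ¬ FiniteDimensional K V) :
    (∀ a b : {t : Submodule K V × Submodule K V × Submodule K V // IsBalanced t},
      ∃ s, IsLUB {a, b} s) ∧
    (∀ a b : {t : Submodule K V × Submodule K V × Submodule K V // IsBalanced t},
      ∃ m, IsGLB {a, b} m) ∧
    (∀ sup inf : {t : Submodule K V × Submodule K V × Submodule K V // IsBalanced t} →
        {t : Submodule K V × Submodule K V × Submodule K V // IsBalanced t} →
        {t : Submodule K V × Submodule K V × Submodule K V // IsBalanced t},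
      (∀ a b, IsLUB {a, b} (sup a b)) → (∀ a b, IsGLB {a, b} (inf a b)) →
      ∀ n : ℕ, 0 < n →
        ¬ ∀ t, ((pqrGen sup inf)^[n] t).1 = ((pqrGen sup inf)^[n + 1] t).1) := by
  refine ⟨exists_isLUB_pair_balanced, fun a b => ⟨_, isGLB_pair_balanced a b⟩, ?_⟩
  intro sup inf hsup hinf n _ h
  obtain ⟨w, e, he⟩ := exists_biorthogonal hV
  have le_sup_l (a b) : a ≤ sup a b := (hsup a b).1 (by simp)
  have le_sup_r (a b) : b ≤ sup a b := (hsup a b).1 (by simp)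
  have sup_le' {a b c} (ha : a ≤ c) (hb : b ≤ c) : sup a b ≤ c :=
    (hsup a b).2 (by rintro _ (rfl | rfl) <;> assumption)
  have inf_val (a b) : (inf a b).1 = a.1 ⊓ b.1 :=
    congrArg Subtype.val ((hinf a b).unique (isGLB_pair_balanced a b))
  have inf_comm' (a b) : inf a b = inf b a := Subtype.ext (by
    rw [inf_val, inf_val, inf_comm])
  let t k := (pqrGen sup inf)^[k] (gridP w 0, gridQ w 0, gridR w)
  have t_succ (k) : t (k + 1) = pqrGen sup inf (t k) := Function.iterate_succ_apply' _ _ _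
  have upper (k) : t k ≤ (gridP w k, gridQ w k, gridR w) := by
    induction k with
    | zero => exact le_rfl
    | succ k ih =>
      obtain ⟨hp, hq, hr⟩ := ih
      rw [t_succ]
      refine ⟨sup_le' (hp.trans (gridP_le_succ w k)) ?_,
        sup_le' (hq.trans (gridQ_le_succ w k)) ?_, sup_le' hr ?_⟩ <;>
        rw [← Subtype.coe_le_coe, inf_val]
      · exact (inf_le_inf hq hr).trans (inf_gridQ_gridR_le w k)
      · exact (inf_le_inf hp hr).trans (inf_gridP_gridR_le w k)
      · exact (inf_le_inf hp hq).trans (inf_gridP_gridQ_le w k)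
  have lower (k) : (gridP w 0, gridQ w 0, gridR w) ≤ t k := by
    induction k with
    | zero => exact le_rfl
    | succ k ih =>
      rw [t_succ]
      exact ih.trans ⟨le_sup_l _ _, le_sup_l _ _, le_sup_l _ _⟩
  have fixed : t n = pqrGen sup inf (t n) :=
    (iterate_pqrGen_eq_of_fst_eq inf_comm' h _).trans (t_succ n)
  have hyz : (t n).2.1.1 ⊓ (t n).2.2.1 ≤ (t n).1.1 := by
    rw [← inf_val, Subtype.coe_le_coe]
    exact (le_sup_r _ _).trans (congrArg Prod.fst fixed).ge
  have hxz : (t n).1.1 ⊓ (t n).2.2.1 ≤ (t n).2.1.1 := by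
    rw [← inf_val, Subtype.coe_le_coe]
    exact (le_sup_r _ _).trans (congrArg (fun s => s.2.1) fixed).ge
  have hmem := (upper n).1.1
    (mem_of_grid_closed he (lower n).1 (lower n).2.1 (lower n).2.2 hyz hxz (n + 1))
  simpa [he] using hmem.2 (n + 1) le_rfl
end

section
/- Let L be a finite lattice satisfying the following conditions. (C1) L has a sublattice G (the grid) containing the bounds 0 and 1 of L, with G isomorphic as a lattice to a direct product C × D of two finite chains. (C2) Every element of H = L ∖ G is doubly irreducible in L: x = a ⊔ b implies x = a or x = b, and x = a ⊓ b implies x = a or x = b. For x ∈ L, write ⌊x⌋ for the largest element of G with ⌊x⌋ ≤ x and ⌈x⌉ for the smallest element of G with x ≤ ⌈x⌉ (these exist since G is a finite sublattice containing 0 and 1). (C3) For x, y ∈ H, ⌊x⌋ = ⌊y⌋ implies x = y, and ⌈x⌉ = ⌈y⌉ implies x = y. (C4) For every x ∈ H, either ⌈x⌉ covers ⌊x⌋ in G and the interval [⌊x⌋, ⌈x⌉] of L is the three-element chain {⌊x⌋, x, ⌈x⌉}, or the interval [⌊x⌋, ⌈x⌉] of G is a prime square (a four-element interval of G isomorphic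 to the lattice 2 × 2, of length two) and the interval [⌊x⌋, ⌈x⌉] of L is a five-element lattice isomorphic to M₃. Then L is 3-modular. -/
open Function

section Balancing

variable {α : Type*} [Lattice α]

theorem isFixedPt_adjT_iff {p q r : α} :
    IsFixedPt adjT (p, q, r) ↔ q ⊓ r ≤ p ∧ p ⊓ r ≤ q ∧ p ⊓ q ≤ r := by
  simp [IsFixedPt, adjT]

theorem isFixedPt_iterate_of_commute {β : Type*} {f σ : β → β} (h : Function.Commute f σ) {n : ℕ}
    {t : β} (ht : IsFixedPt f (f^[n] t)) : IsFixedPt f (f^[n] (σ t)) := by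
  rw [(h.iterate_left n).eq t]
  exact ht.map h.symm.semiconj

theorem isFixedPt_iterate_of_le {β : Type*} {f : β → β} {m n : ℕ} (hmn : m ≤ n) {t : β}
    (ht : IsFixedPt f (f^[m] t)) : IsFixedPt f (f^[n] t) := by
  obtain ⟨k, rfl⟩ := Nat.exists_eq_add_of_le' hmn
  rwa [iterate_add_apply, (ht.iterate k).eq]

/-- Exchange the first two entries of a triple. -/
def swapFst {β : Type*} (t : β × β × β) : β × β × β := (t.2.1, t.1, t.2.2)

/-- Exchange the last two entries of a triple. -/
def swapSnd {β : Type*} (t : β × β × β) : β × β × β := (t.1, t.2.2, t.2.1)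

theorem adjT_commute_swapFst : Function.Commute (adjT (α := α)) swapFst := fun t => by
  simp [adjT, swapFst, inf_comm]

theorem adjT_commute_swapSnd : Function.Commute (adjT (α := α)) swapSnd := fun t => by
  simp [adjT, swapSnd, inf_comm]

theorem isFixedPt_adjT_swapFst {n : ℕ} {x y z : α} (h : IsFixedPt adjT (adjT^[n] (y, x, z))) :
    IsFixedPt adjT (adjT^[n] (x, y, z)) :=
  isFixedPt_iterate_of_commute adjT_commute_swapFst h

theorem isFixedPt_adjT_swapSnd {n : ℕ} {x y z : α} (h : IsFixedPt adjT (adjT^[n] (x, z, y))) :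
    IsFixedPt adjT (adjT^[n] (x, y, z)) :=
  isFixedPt_iterate_of_commute adjT_commute_swapSnd h

theorem isFixedPt_adjT_of_le {x y : α} (z : α) (h : x ≤ y) :
    IsFixedPt adjT (adjT^[2] (x, y, z)) := by
  have hp : x ⊔ y ⊓ z ≤ y := sup_le h inf_le_left
  have hr : x ⊔ y ⊓ z ≤ z ⊔ x := sup_le le_sup_right (inf_le_right.trans le_sup_left)
  have hq : x ⊓ z ≤ y := inf_le_left.trans h
  have hpr : (x ⊔ y ⊓ z) ⊓ (z ⊔ x) ≤ y := inf_le_left.trans hp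
  simp only [iterate_succ, iterate_zero, comp_apply, id_eq, adjT, inf_eq_left.2 h,
    sup_eq_left.2 hq, inf_eq_left.2 hp, sup_eq_left.2 hpr, sup_eq_left.2 hr]
  rw [isFixedPt_adjT_iff]
  exact ⟨le_sup_right, inf_le_left.trans (sup_le hp inf_le_left),
    inf_le_left.trans (sup_le hr inf_le_right)⟩

theorem isFixedPt_adjT_of_not_incompRel {x y : α} (z : α) (h : ¬ IncompRel (· ≤ ·) x y) :
    IsFixedPt adjT (adjT^[2] (x, y, z)) := by
  by_cases hxy : x ≤ y
  · exact isFixedPt_adjT_of_le z hxy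
  · by_cases hyx : y ≤ x
    · exact isFixedPt_adjT_swapFst (isFixedPt_adjT_of_le z hyx)
    · exact absurd ⟨hxy, hyx⟩ h

theorem isFixedPt_adjT_or_incompRel (x y z : α) :
    IsFixedPt adjT (adjT^[2] (x, y, z)) ∨
      IncompRel (· ≤ ·) x y ∧ IncompRel (· ≤ ·) x z ∧ IncompRel (· ≤ ·) y z := by
  by_cases hxy : IncompRel (· ≤ ·) x y
  · by_cases hxz : IncompRel (· ≤ ·) x z
    · by_cases hyz : IncompRel (· ≤ ·) y z
      · exact Or.inr ⟨hxy, hxz, hyz⟩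
      · exact Or.inl (isFixedPt_adjT_swapFst
          (isFixedPt_adjT_swapSnd (isFixedPt_adjT_of_not_incompRel x hyz)))
    · exact Or.inl (isFixedPt_adjT_swapSnd (isFixedPt_adjT_of_not_incompRel y hxz))
  · exact Or.inl (isFixedPt_adjT_of_not_incompRel z hxy)

end Balancing

section Plane

theorem Prod.nat_le_of_not_inf_le {a b c c' : ℕ × ℕ} (hc : c' ≤ c + 1) (hbc : b ⊓ c ≤ a)
    (hac : a ⊓ c ≤ b) (hab : ¬ a ⊓ b ≤ c) (h : ¬ b ⊓ c' ≤ a) : c' ≤ b := by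
  simp only [Prod.le_def, Prod.fst_inf, Prod.snd_inf, Prod.fst_add, Prod.snd_add, Prod.fst_one,
    Prod.snd_one] at *
  omega

theorem Prod.nat_not_le_sup {a a' b b' c c' q r : ℕ × ℕ} (ha : ¬ a' ≤ a)
    (hb : b ≤ b') (hc : c' ≤ c + 1) (hq : q = b' ⊔ a ⊓ c) (hr : r = c' ⊔ a ⊓ b)
    (hqr : q ⊓ r ≤ a) (hra : ¬ r ≤ a) (haq : ¬ a' ≤ q) : ¬ a' ≤ q ⊔ a ⊓ r := by
  subst hq hr
  simp only [Prod.le_def, Prod.fst_inf, Prod.snd_inf, Prod.fst_add, Prod.snd_add, Prod.fst_one,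
    Prod.snd_one, Prod.fst_sup, Prod.snd_sup] at *
  omega

end Plane

/-- The properties of a grid sublattice `G` of a lattice, with lower and upper approximations
`fl` and `ce` in `G` and a coordinate map `Φ` on `G`, which force the lattice to be
`3`-modular. -/
structure IsGridded {α : Type*} [Lattice α] (G : Sublattice α) (fl ce : α → α)
    (Φ : α → ℕ × ℕ) : Prop where
  fl_mem : ∀ x, fl x ∈ G
  fl_le : ∀ x, fl x ≤ x
  le_fl : ∀ {x g}, g ∈ G → g ≤ x → g ≤ fl x
  ce_mem : ∀ x, ce x ∈ G
  le_ce : ∀ x, x ≤ ce x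
  ce_le : ∀ {x g}, g ∈ G → x ≤ g → ce x ≤ g
  inf_eq : ∀ {x y}, ¬ x ≤ y → x ⊓ y = fl x ⊓ y
  sup_eq : ∀ {x y}, ¬ y ≤ x → x ⊔ y = ce x ⊔ y
  map_le : ∀ {g h}, g ∈ G → h ∈ G → (Φ g ≤ Φ h ↔ g ≤ h)
  map_inf : ∀ {g h}, g ∈ G → h ∈ G → Φ (g ⊓ h) = Φ g ⊓ Φ h
  map_sup : ∀ {g h}, g ∈ G → h ∈ G → Φ (g ⊔ h) = Φ g ⊔ Φ h
  map_ce_le : ∀ x, Φ (ce x) ≤ Φ (fl x) + 1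

namespace IsGridded

variable {α : Type*} [Lattice α] {G : Sublattice α} {fl ce : α → α} {Φ : α → ℕ × ℕ}
  {x y z : α}

theorem fl_of_mem (h : IsGridded G fl ce Φ) (hx : x ∈ G) : fl x = x :=
  (h.fl_le x).antisymm (h.le_fl hx le_rfl)

theorem ce_of_mem (h : IsGridded G fl ce Φ) (hx : x ∈ G) : ce x = x :=
  (h.ce_le hx le_rfl).antisymm (h.le_ce x)

theorem inf_eq_fl_inf_fl (h : IsGridded G fl ce Φ) (hxy : IncompRel (· ≤ ·) x y) :
    x ⊓ y = fl x ⊓ fl y := by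
  apply le_antisymm _ (inf_le_inf (h.fl_le x) (h.fl_le y))
  refine le_inf ?_ ?_
  · exact (h.inf_eq hxy.1).le.trans inf_le_left
  · rw [inf_comm]
    exact (h.inf_eq hxy.2).le.trans inf_le_left

theorem inf_mem (h : IsGridded G fl ce Φ) (hxy : IncompRel (· ≤ ·) x y) : x ⊓ y ∈ G := by
  rw [h.inf_eq_fl_inf_fl hxy]
  exact G.inf_mem (h.fl_mem x) (h.fl_mem y)

theorem sup_mem_of_not_le (h : IsGridded G fl ce Φ) (hy : y ∈ G) (hyx : ¬ y ≤ x) :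
    x ⊔ y ∈ G := by
  rw [h.sup_eq hyx]
  exact G.sup_mem (h.ce_mem x) hy

theorem sup_eq_of_sup_mem (h : IsGridded G fl ce Φ) (hxy : x ⊔ y ∈ G) :
    x ⊔ y = ce x ⊔ y := by
  by_cases hyx : y ≤ x
  · rw [sup_eq_left.2 hyx] at hxy
    rw [h.ce_of_mem hxy]
  · exact h.sup_eq hyx

theorem isFixedPt_of_mem (h : IsGridded G fl ce Φ) (hx : x ∈ G) (hy : y ∈ G) (hz : z ∈ G) :
    IsFixedPt adjT (adjT (x, y, z)) := by
  have key : ∀ {a b c : α}, a ∈ G → b ∈ G → c ∈ G →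
      (b ⊔ a ⊓ c) ⊓ (c ⊔ a ⊓ b) ≤ a ⊔ b ⊓ c := by
    intro a b c ha hb hc
    have hbc := G.inf_mem hb hc
    have hac := G.inf_mem ha hc
    have hab := G.inf_mem ha hb
    have h1 := G.sup_mem hb hac
    have h2 := G.sup_mem hc hab
    rw [← h.map_le (G.inf_mem h1 h2) (G.sup_mem ha hbc), h.map_inf h1 h2, h.map_sup hb hac,
      h.map_sup hc hab, h.map_sup ha hbc, h.map_inf hb hc, h.map_inf ha hc, h.map_inf ha hb]
    simp only [Prod.le_def, Prod.fst_inf, Prod.snd_inf, Prod.fst_sup, Prod.snd_sup]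
    omega
  refine isFixedPt_adjT_iff.2 ⟨key hx hy hz, ?_, ?_⟩
  · simpa [inf_comm] using key hy hx hz
  · simpa [inf_comm] using key hz hx hy

theorem inf_sup_inf_le (h : IsGridded G fl ce Φ) (hxy : IncompRel (· ≤ ·) x y)
    (hxz : IncompRel (· ≤ ·) x z) (hyz : IncompRel (· ≤ ·) y z)
    (hx : y ⊓ z ≤ x) (hy : x ⊓ z ≤ y) (hz : ¬ x ⊓ y ≤ z)
    (hyz' : IncompRel (· ≤ ·) y (z ⊔ x ⊓ y)) : y ⊓ (z ⊔ x ⊓ y) ≤ x := by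
  have hxyG := h.inf_mem hxy
  have hz' := h.sup_eq hz
  have hz'G := h.sup_mem_of_not_le hxyG hz
  by_contra hn
  have hab := G.inf_mem (h.fl_mem x) (h.fl_mem y)
  have hbc := G.inf_mem (h.fl_mem y) (h.fl_mem z)
  have hac := G.inf_mem (h.fl_mem x) (h.fl_mem z)
  have hbc' := G.inf_mem (h.fl_mem y) (h.ce_mem z)
  have hle : Φ (ce z) ≤ Φ (fl y) := by
    refine Prod.nat_le_of_not_inf_le (h.map_ce_le z) (a := Φ (fl x)) ?_ ?_ ?_ ?_
    · rw [← h.map_inf (h.fl_mem y) (h.fl_mem z), h.map_le hbc (h.fl_mem x),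
        ← h.inf_eq_fl_inf_fl hyz]
      exact h.le_fl (h.inf_mem hyz) hx
    · rw [← h.map_inf (h.fl_mem x) (h.fl_mem z), h.map_le hac (h.fl_mem y),
        ← h.inf_eq_fl_inf_fl hxz]
      exact h.le_fl (h.inf_mem hxz) hy
    · rw [← h.map_inf (h.fl_mem x) (h.fl_mem y), h.map_le hab (h.fl_mem z),
        ← h.inf_eq_fl_inf_fl hxy]
      exact fun hle => hz (hle.trans (h.fl_le z))
    · intro hle
      apply hn
      rw [h.inf_eq hyz'.1, hz', h.inf_eq_fl_inf_fl hxy]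
      refine le_trans ?_ (h.fl_le x)
      rw [← h.map_le (G.inf_mem (h.fl_mem y) (G.sup_mem (h.ce_mem z) hab)) (h.fl_mem x),
        h.map_inf (h.fl_mem y) (G.sup_mem (h.ce_mem z) hab), h.map_sup (h.ce_mem z) hab,
        h.map_inf (h.fl_mem x) (h.fl_mem y), inf_sup_left]
      exact sup_le hle (inf_le_right.trans inf_le_left)
  rw [h.map_le (h.ce_mem z) (h.fl_mem y)] at hle
  apply hyz'.2
  rw [hz']
  exact sup_le (hle.trans (h.fl_le y)) inf_le_right

theorem isFixedPt_of_inf_le_of_inf_le (h : IsGridded G fl ce Φ)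
    (hxy : IncompRel (· ≤ ·) x y) (hxz : IncompRel (· ≤ ·) x z) (hyz : IncompRel (· ≤ ·) y z)
    (hx : y ⊓ z ≤ x) (hy : x ⊓ z ≤ y) (hxz' : IncompRel (· ≤ ·) x (z ⊔ x ⊓ y))
    (hyz' : IncompRel (· ≤ ·) y (z ⊔ x ⊓ y)) : IsFixedPt adjT (adjT (x, y, z)) := by
  by_cases hz : x ⊓ y ≤ z
  · have ht : IsFixedPt adjT (x, y, z) := isFixedPt_adjT_iff.2 ⟨hx, hy, hz⟩
    rwa [ht.eq]
  · simp only [adjT, sup_eq_left.2 hx, sup_eq_left.2 hy]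
    refine isFixedPt_adjT_iff.2 ⟨h.inf_sup_inf_le hxy hxz hyz hx hy hz hyz', ?_, le_sup_right⟩
    rw [inf_comm x y] at hxz' hz ⊢
    exact h.inf_sup_inf_le hxy.symm hyz hxz hy hx hz hxz'

theorem not_le_sup_inf (h : IsGridded G fl ce Φ)
    (hxy : IncompRel (· ≤ ·) x y) (hxz : IncompRel (· ≤ ·) x z) (hxG : x ∉ G)
    (hy'G : y ⊔ x ⊓ z ∈ G) (hz'G : z ⊔ x ⊓ y ∈ G)
    (hxy' : IncompRel (· ≤ ·) x (y ⊔ x ⊓ z)) (hxz' : IncompRel (· ≤ ·) x (z ⊔ x ⊓ y))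
    (hle : (y ⊔ x ⊓ z) ⊓ (z ⊔ x ⊓ y) ≤ x) :
    ¬ x ≤ (y ⊔ x ⊓ z) ⊔ x ⊓ (z ⊔ x ⊓ y) := by
  have ha := h.fl_mem x
  have hac := G.inf_mem ha (h.fl_mem z)
  have hab := G.inf_mem ha (h.fl_mem y)
  have hq := h.sup_eq_of_sup_mem hy'G
  have hr := h.sup_eq_of_sup_mem hz'G
  generalize y ⊔ x ⊓ z = q at *
  generalize z ⊔ x ⊓ y = r at *
  rw [h.inf_eq_fl_inf_fl hxz] at hq
  rw [h.inf_eq_fl_inf_fl hxy] at hr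
  have har := G.inf_mem ha hz'G
  intro hx
  rw [h.inf_eq hxz'.1] at hx
  have hx' := h.ce_le (G.sup_mem hy'G har) hx
  rw [← h.map_le (h.ce_mem x) (G.sup_mem hy'G har), h.map_sup hy'G har,
    h.map_inf ha hz'G] at hx'
  refine Prod.nat_not_le_sup (b := Φ (fl y)) (b' := Φ (ce y)) (c := Φ (fl z)) (c' := Φ (ce z))
    ?_ ?_ (h.map_ce_le z) ?_ ?_ ?_ ?_ ?_ hx'
  · rw [h.map_le (h.ce_mem x) ha]
    intro hcf
    exact hxG (le_antisymm ((h.le_ce x).trans hcf) (h.fl_le x) ▸ ha)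
  · rw [h.map_le (h.fl_mem y) (h.ce_mem y)]
    exact (h.fl_le y).trans (h.le_ce y)
  · rw [hq, h.map_sup (h.ce_mem y) hac, h.map_inf ha (h.fl_mem z)]
  · rw [hr, h.map_sup (h.ce_mem z) hab, h.map_inf ha (h.fl_mem y)]
  · rw [← h.map_inf hy'G hz'G, h.map_le (G.inf_mem hy'G hz'G) ha]
    exact h.le_fl (G.inf_mem hy'G hz'G) hle
  · rw [h.map_le hz'G ha]
    exact fun hra => hxz'.2 (hra.trans (h.fl_le x))
  · rw [h.map_le (h.ce_mem x) hy'G]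
    exact fun hcq => hxy'.1 ((h.le_ce x).trans hcq)

theorem isFixedPt_of_inf_le (h : IsGridded G fl ce Φ)
    (hxy : IncompRel (· ≤ ·) x y) (hxz : IncompRel (· ≤ ·) x z) (hxG : x ∉ G)
    (hx : y ⊓ z ≤ x) (hy'G : y ⊔ x ⊓ z ∈ G) (hz'G : z ⊔ x ⊓ y ∈ G)
    (hxy' : IncompRel (· ≤ ·) x (y ⊔ x ⊓ z)) (hxz' : IncompRel (· ≤ ·) x (z ⊔ x ⊓ y)) :
    IsFixedPt adjT (adjT^[3] (x, y, z)) := by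
  have hle₁ := h.not_le_sup_inf hxy hxz hxG hy'G hz'G hxy' hxz'
  have hle₂ := h.not_le_sup_inf hxz hxy hxG hz'G hy'G hxz' hxy'
  have ht : adjT (x, y, z) = (x, y ⊔ x ⊓ z, z ⊔ x ⊓ y) := by simp [adjT, hx]
  rw [iterate_succ_apply, ht]
  generalize y ⊔ x ⊓ z = q at *
  generalize z ⊔ x ⊓ y = r at *
  have hxq := h.inf_mem hxy'
  have hxr := h.inf_mem hxz'
  have hq' := G.sup_mem hy'G hxr
  have hr' := G.sup_mem hz'G hxq
  by_cases hqr : q ⊓ r ≤ x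
  · replace hle₁ := hle₁ hqr
    replace hle₂ := hle₂ (inf_comm q r ▸ hqr)
    have ha := h.fl_mem x
    have hqra := h.le_fl (G.inf_mem hy'G hz'G) hqr
    have har := G.inf_mem ha hz'G
    have haq := G.inf_mem ha hy'G
    rw [← h.map_le (G.inf_mem hy'G hz'G) ha, h.map_inf hy'G hz'G] at hqra
    refine isFixedPt_iterate_of_le (m := 1) one_le_two ?_
    rw [iterate_one]
    simp only [adjT, sup_eq_left.2 hqr]
    rw [isFixedPt_adjT_iff, h.inf_eq hle₁, h.inf_eq hle₂]
    rw [h.inf_eq hxy'.1, h.inf_eq hxz'.1] at *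
    refine ⟨le_trans ?_ (h.fl_le x), ?_, ?_⟩
    · rw [← h.map_le (G.inf_mem hq' hr') ha, h.map_inf hq' hr', h.map_sup hy'G har,
        h.map_sup hz'G haq, h.map_inf ha hz'G, h.map_inf ha hy'G]
      simp only [Prod.le_def, Prod.fst_inf, Prod.snd_inf, Prod.fst_sup, Prod.snd_sup] at *
      omega
    · rw [← h.map_le (G.inf_mem ha hr') hq', h.map_inf ha hr', h.map_sup hy'G har,
        h.map_sup hz'G haq, h.map_inf ha hz'G, h.map_inf ha hy'G]
      simp only [Prod.le_def, Prod.fst_inf, Prod.snd_inf, Prod.fst_sup, Prod.snd_sup] at *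
      omega
    · rw [← h.map_le (G.inf_mem ha hq') hr', h.map_inf ha hq', h.map_sup hy'G har,
        h.map_sup hz'G haq, h.map_inf ha hz'G, h.map_inf ha hy'G]
      simp only [Prod.le_def, Prod.fst_inf, Prod.snd_inf, Prod.fst_sup, Prod.snd_sup] at *
      omega
  · exact h.isFixedPt_of_mem (h.sup_mem_of_not_le (G.inf_mem hy'G hz'G) hqr) hq' hr'

theorem isFixedPt_adjT (h : IsGridded G fl ce Φ) (x y z : α) :
    IsFixedPt adjT (adjT^[3] (x, y, z)) := by
  obtain hfix | ⟨hxy, hxz, hyz⟩ := isFixedPt_adjT_or_incompRel x y z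
  · exact isFixedPt_iterate_of_le (by norm_num) hfix
  obtain hfix | ⟨hxy', hxz', hyz'⟩ :=
    isFixedPt_adjT_or_incompRel (x ⊔ y ⊓ z) (y ⊔ x ⊓ z) (z ⊔ x ⊓ y)
  · exact hfix
  have out : ∀ {a b c : α}, IncompRel (· ≤ ·) b c → a ⊔ b ⊓ c ∉ G → b ⊓ c ≤ a :=
    fun hbc ha => not_not.1 fun hn => ha (h.sup_mem_of_not_le (h.inf_mem hbc) hn)
  by_cases hx : x ⊔ y ⊓ z ∈ G
  · by_cases hy : y ⊔ x ⊓ z ∈ G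
    · by_cases hz : z ⊔ x ⊓ y ∈ G
      · exact isFixedPt_iterate_of_le (m := 2) (by norm_num) (h.isFixedPt_of_mem hx hy hz)
      · have hz' := out hxy hz
        rw [sup_eq_left.2 hz'] at hz hxz' hyz'
        rw [inf_comm y z] at hx hxz'
        rw [inf_comm x z] at hy hyz'
        exact isFixedPt_adjT_swapSnd (isFixedPt_adjT_swapFst
          (h.isFixedPt_of_inf_le hxz.symm hyz.symm hz hz' hx hy hxz'.symm hyz'.symm))
    · have hy' := out hxz hy
      rw [sup_eq_left.2 hy'] at hy hxy' hyz'
      by_cases hz : z ⊔ x ⊓ y ∈ G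
      · rw [inf_comm x y] at hz hyz'
        exact isFixedPt_adjT_swapFst
          (h.isFixedPt_of_inf_le hxy.symm hyz hy hy' hx hz hxy'.symm hyz')
      · have hz' := out hxy hz
        rw [sup_eq_left.2 hz'] at hxz'
        refine isFixedPt_adjT_swapFst (isFixedPt_adjT_swapSnd
          (isFixedPt_iterate_of_le (m := 1) (by norm_num)
          (h.isFixedPt_of_inf_le_of_inf_le hyz hxy.symm hxz.symm ?_ ?_ hxy'.symm hxz'.symm)))
        · rwa [inf_comm]
        · rwa [inf_comm]
  · have hx' := out hyz hx
    rw [sup_eq_left.2 hx'] at hx hxy' hxz'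
    by_cases hy : y ⊔ x ⊓ z ∈ G
    · by_cases hz : z ⊔ x ⊓ y ∈ G
      · exact h.isFixedPt_of_inf_le hxy hxz hx hx' hy hz hxy' hxz'
      · have hz' := out hxy hz
        rw [sup_eq_left.2 hz'] at hyz'
        refine isFixedPt_adjT_swapSnd (isFixedPt_iterate_of_le (m := 1) (by norm_num)
          (h.isFixedPt_of_inf_le_of_inf_le hxz hxy hyz.symm ?_ hz' hxy' hyz'.symm))
        rwa [inf_comm]
    · have hy' := out hxz hy
      rw [sup_eq_left.2 hy'] at hyz'
      exact isFixedPt_iterate_of_le (m := 1) (by norm_num)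
        (h.isFixedPt_of_inf_le_of_inf_le hxy hxz hyz hx' hy' hxz' hyz')

end IsGridded

section Approximation

variable {α : Type*} [Lattice α] {a b x y : α}

/-- An element covering `a` which is not a nontrivial join meets any element not above it
in the same way as `a`. -/
theorem CovBy.inf_eq_of_eq_sup (hax : a ⋖ x) (hx : ∀ u v, x = u ⊔ v → x = u ∨ x = v)
    (hxy : ¬ x ≤ y) : x ⊓ y = a ⊓ y := by
  refine le_antisymm (le_inf ?_ inf_le_right) (inf_le_inf_right y hax.le)
  obtain h | h := hax.eq_or_eq le_sup_left (sup_le hax.le (inf_le_left (b := y)))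
  · exact sup_eq_left.1 h
  · obtain h | h := hx _ _ h.symm
    · exact absurd h hax.ne'
    · exact absurd (inf_eq_left.1 h.symm) hxy

/-- An element covered by `b` which is not a nontrivial meet joins any element not below it
in the same way as `b`. -/
theorem CovBy.sup_eq_of_eq_inf (hxb : x ⋖ b) (hx : ∀ u v, x = u ⊓ v → x = u ∨ x = v)
    (hyx : ¬ y ≤ x) : x ⊔ y = b ⊔ y :=
  hxb.toDual.inf_eq_of_eq_sup (α := αᵒᵈ) hx hyx

end Approximation

section Coordinates

theorem Prod.nat_le_add_one_of_cases {m n : ℕ} {c c' : Fin m × Fin n} (h : c ≤ c')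
    (hcc : (∀ g, ¬ (c < g ∧ g < c')) ∨ ∃ u v, u ⊓ v = c ∧ u ⊔ v = c' ∧
      ∀ g, c ≤ g → g ≤ c' → g = c ∨ g = u ∨ g = v ∨ g = c') :
    (c'.1.1, c'.2.1) ≤ ((c.1.1, c.2.1) + 1 : ℕ × ℕ) := by
  obtain ⟨⟨c₁, hc₁⟩, ⟨c₂, hc₂⟩⟩ := c
  obtain ⟨⟨d₁, hd₁⟩, ⟨d₂, hd₂⟩⟩ := c'
  have hcd : c₁ ≤ d₁ ∧ c₂ ≤ d₂ := h
  rw [Prod.le_def]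
  by_contra hn
  have hn' : c₁ + 1 < d₁ ∨ c₂ + 1 < d₂ := by
    simp only [Prod.fst_add, Prod.snd_add, Prod.fst_one, Prod.snd_one] at hn
    omega
  obtain hcov | ⟨⟨⟨u₁, hu₁⟩, ⟨u₂, hu₂⟩⟩, ⟨⟨v₁, hv₁⟩, ⟨v₂, hv₂⟩⟩, hi, hs, hsq⟩ := hcc
  · obtain h1 | h1 := hn'
    · have := hcov (⟨c₁ + 1, by omega⟩, ⟨c₂, hc₂⟩)
      simp only [lt_iff_le_not_ge, Prod.mk_le_mk, Fin.mk_le_mk] at this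
      omega
    · have := hcov (⟨c₁, hc₁⟩, ⟨c₂ + 1, by omega⟩)
      simp only [lt_iff_le_not_ge, Prod.mk_le_mk, Fin.mk_le_mk] at this
      omega
  · simp only [Prod.ext_iff, Fin.ext_iff, Prod.fst_inf, Prod.snd_inf, Prod.fst_sup, Prod.snd_sup,
      Fin.coe_min, Fin.coe_max] at hi hs
    obtain h1 | h1 := hn'
    · have := hsq (⟨c₁ + 1, by omega⟩, ⟨c₂, hc₂⟩)
      simp only [Prod.mk_le_mk, Fin.mk_le_mk, Prod.mk.injEq, Fin.mk.injEq] at this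
      omega
    · have := hsq (⟨c₁, hc₁⟩, ⟨c₂ + 1, by omega⟩)
      simp only [Prod.mk_le_mk, Fin.mk_le_mk, Prod.mk.injEq, Fin.mk.injEq] at this
      omega

end Coordinates

/-- Let `L` be a finite bounded lattice with a sublattice `G` (the grid) satisfying:
(C1) `G` contains `⊥` and `⊤` and is isomorphic to a product of two finite nonempty chains;
(C2) every element outside `G` is doubly irreducible;
(with `fl x = ⌊x⌋` the largest grid element below `x` and `ce x = ⌈x⌉` the smallest grid
element above `x`)
(C3) distinct elements of `H = L ∖ G` have distinct `⌊·⌋` and distinct `⌈·⌉`;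
(C4) for `x ∈ H`, either `⌈x⌉` covers `⌊x⌋` in `G` and `[⌊x⌋, ⌈x⌉]` in `L` is the
three-element chain `{⌊x⌋, x, ⌈x⌉}`, or `[⌊x⌋, ⌈x⌉]` in `G` is a prime square `{⌊x⌋, u, v, ⌈x⌉}`
and `[⌊x⌋, ⌈x⌉]` in `L` is the five-element lattice `{⌊x⌋, u, v, x, ⌈x⌉} ≅ M₃`.
Then `L` is `3`-modular. -/
theorem stmt18 {α : Type*} [Lattice α] [Fintype α] [BoundedOrder α]
    (G : Sublattice α) (hbot : (⊥ : α) ∈ G) (htop : (⊤ : α) ∈ G)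
    (hgrid : ∃ m n : ℕ, Nonempty (G ≃o Fin (m + 1) × Fin (n + 1)))
    (hC2 : ∀ x : α, x ∉ G →
      (∀ u v : α, x = u ⊔ v → x = u ∨ x = v) ∧ (∀ u v : α, x = u ⊓ v → x = u ∨ x = v))
    (fl ce : α → α)
    (hfl : ∀ x : α, fl x ∈ G ∧ fl x ≤ x ∧ ∀ g ∈ G, g ≤ x → g ≤ fl x)
    (hce : ∀ x : α, ce x ∈ G ∧ x ≤ ce x ∧ ∀ g ∈ G, x ≤ g → ce x ≤ g)
    (hC3 : ∀ x y : α, x ∉ G → y ∉ G →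
      ((fl x = fl y → x = y) ∧ (ce x = ce y → x = y)))
    (hC4 : ∀ x : α, x ∉ G →
      ((fl x < ce x ∧ (∀ g ∈ G, ¬ (fl x < g ∧ g < ce x)) ∧
        (∀ y : α, fl x ≤ y → y ≤ ce x → y = fl x ∨ y = x ∨ y = ce x)) ∨
       (∃ u v : α, u ∈ G ∧ v ∈ G ∧ u ≠ v ∧
        fl x < u ∧ u < ce x ∧ fl x < v ∧ v < ce x ∧
        u ⊓ v = fl x ∧ u ⊔ v = ce x ∧
        (∀ g ∈ G, fl x ≤ g → g ≤ ce x → g = fl x ∨ g = u ∨ g = v ∨ g = ce x) ∧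
        x ⊓ u = fl x ∧ x ⊓ v = fl x ∧ x ⊔ u = ce x ∧ x ⊔ v = ce x ∧
        (∀ y : α, fl x ≤ y → y ≤ ce x → y = fl x ∨ y = u ∨ y = v ∨ y = x ∨ y = ce x)))) :
    NModular α 3 := by
  obtain ⟨m, n, ⟨e⟩⟩ := hgrid
  have fl_eq : ∀ x ∈ G, fl x = x := fun x hx =>
    (hfl x).2.1.antisymm ((hfl x).2.2 x hx le_rfl)
  have ce_eq : ∀ x ∈ G, ce x = x := fun x hx =>
    ((hce x).2.2 x hx le_rfl).antisymm (hce x).2.1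
  have fl_covBy : ∀ x ∉ G, fl x ⋖ x := by
    intro x hx
    refine ⟨lt_of_le_of_ne (hfl x).2.1 fun h => hx (h ▸ (hfl x).1), fun y h₁ h₂ => ?_⟩
    have hyc := h₂.le.trans (hce x).2.1
    obtain ⟨-, -, h⟩ | ⟨u, v, -, -, -, hu, -, hv, -, -, -, -, hxu, hxv, -, -, h⟩ := hC4 x hx
    · obtain rfl | rfl | rfl := h y h₁.le hyc
      · exact h₁.false
      · exact h₂.false
      · exact h₂.not_ge (hce x).2.1
    · obtain rfl | rfl | rfl | rfl | rfl := h y h₁.le hyc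
      · exact h₁.false
      · exact hu.ne' ((inf_eq_right.2 h₂.le).symm.trans hxu)
      · exact hv.ne' ((inf_eq_right.2 h₂.le).symm.trans hxv)
      · exact h₂.false
      · exact h₂.not_ge (hce x).2.1
  have covBy_ce : ∀ x ∉ G, x ⋖ ce x := by
    intro x hx
    refine ⟨lt_of_le_of_ne (hce x).2.1 fun h => hx (h ▸ (hce x).1), fun y h₁ h₂ => ?_⟩
    have hfy := (hfl x).2.1.trans h₁.le
    obtain ⟨-, -, h⟩ | ⟨u, v, -, -, -, -, hu, -, hv, -, -, -, -, -, hxu, hxv, h⟩ := hC4 x hx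
    · obtain rfl | rfl | rfl := h y hfy h₂.le
      · exact h₁.not_ge (hfl x).2.1
      · exact h₁.false
      · exact h₂.false
    · obtain rfl | rfl | rfl | rfl | rfl := h y hfy h₂.le
      · exact h₁.not_ge (hfl x).2.1
      · exact hu.ne ((sup_eq_right.2 h₁.le).symm.trans hxu)
      · exact hv.ne ((sup_eq_right.2 h₁.le).symm.trans hxv)
      · exact h₁.false
      · exact h₂.false
  classical
  let Φ : α → ℕ × ℕ := fun x => if h : x ∈ G then ((e ⟨x, h⟩).1.1, (e ⟨x, h⟩).2.1) else 0
  have hΦ : ∀ {x} (h : x ∈ G), Φ x = ((e ⟨x, h⟩).1.1, (e ⟨x, h⟩).2.1) := fun h => dif_pos h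
  have hG : IsGridded G fl ce Φ :=
    { fl_mem := fun x => (hfl x).1
      fl_le := fun x => (hfl x).2.1
      le_fl := fun hg hgx => (hfl _).2.2 _ hg hgx
      ce_mem := fun x => (hce x).1
      le_ce := fun x => (hce x).2.1
      ce_le := fun hg hgx => (hce _).2.2 _ hg hgx
      inf_eq := by
        intro x y hxy
        by_cases hx : x ∈ G
        · rw [fl_eq x hx]
        · exact (fl_covBy x hx).inf_eq_of_eq_sup (hC2 x hx).1 hxy
      sup_eq := by
        intro x y hxy
        by_cases hx : x ∈ G
        · rw [ce_eq x hx]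
        · exact (covBy_ce x hx).sup_eq_of_eq_inf (hC2 x hx).2 hxy
      map_le := by
        intro g h hg hh
        rw [hΦ hg, hΦ hh]
        exact e.le_iff_le (x := ⟨g, hg⟩) (y := ⟨h, hh⟩)
      map_inf := by
        intro g h hg hh
        have := e.map_inf ⟨g, hg⟩ ⟨h, hh⟩
        rw [Sublattice.mk_inf_mk] at this
        rw [hΦ hg, hΦ hh, hΦ (G.inf_mem hg hh), this]
        rfl
      map_sup := by
        intro g h hg hh
        have := e.map_sup ⟨g, hg⟩ ⟨h, hh⟩
        rw [Sublattice.mk_sup_mk] at this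
        rw [hΦ hg, hΦ hh, hΦ (G.sup_mem hg hh), this]
        rfl
      map_ce_le := by
        intro x
        rw [hΦ (hce x).1, hΦ (hfl x).1]
        refine Prod.nat_le_add_one_of_cases (e.monotone ((hfl x).2.1.trans (hce x).2.1)) ?_
        by_cases hx : x ∈ G
        · left
          simp only [fl_eq x hx, ce_eq x hx]
          exact fun g hg => (hg.1.trans hg.2).false
        · obtain ⟨-, h, -⟩ | ⟨u, v, hu, hv, -, -, -, -, -, hi, hs, h, -⟩ := hC4 x hx
          · left
            intro g hg
            rw [← e.apply_symm_apply g, e.lt_iff_lt, e.lt_iff_lt] at hg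
            exact h _ (e.symm g).2 hg
          · refine Or.inr ⟨e ⟨u, hu⟩, e ⟨v, hv⟩, ?_, ?_, fun g h₁ h₂ => ?_⟩
            · rw [← e.map_inf]
              exact congrArg e (Subtype.ext hi)
            · rw [← e.map_sup]
              exact congrArg e (Subtype.ext hs)
            · rw [← e.apply_symm_apply g] at h₁ h₂ ⊢
              rw [e.le_iff_le] at h₁ h₂
              simpa only [e.injective.eq_iff, Subtype.ext_iff] using h _ (e.symm g).2 h₁ h₂ }
  rintro ⟨x, y, z⟩
  rw [iterate_succ_apply' adjT 3, (hG.isFixedPt_adjT x y z).eq]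
end

section
/- Every finite distributive lattice D is isomorphic to the congruence lattice Con L of some finite 3-modular lattice L, i.e., there exists a finite lattice L satisfying the identity γ₃ such that D is isomorphic to the lattice of all congruences of L ordered by inclusion. -/
/-- A congruence of a lattice: an equivalence relation with the substitution properties. -/
def IsLatCon {α : Type*} [Lattice α] (Θ : α → α → Prop) : Prop :=
  Equivalence Θ ∧ (∀ a b c, Θ a b → Θ (a ⊔ c) (b ⊔ c)) ∧
    (∀ a b c, Θ a b → Θ (a ⊓ c) (b ⊓ c))


/-- A coordinate `c` is active in `x` if it is maximal or lies strictly below the support of `x`. -/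
def IsActive {P : Type*} [PartialOrder P] (x : P → Bool → Prop) (c : P) : Prop :=
  IsMax c ∨ ∃ d, c < d ∧ ∃ b, x d b

/-- The subsets of `P × Bool` whose fibre over every active coordinate is empty or full. -/
@[ext]
structure FillSet (P : Type*) [PartialOrder P] where
  /-- The membership predicate. -/
  mem : P → Bool → Prop
  fill : ∀ c, IsActive mem c → ∀ b b', mem c b → mem c b'

namespace FillSet

variable {P : Type*} [PartialOrder P]

instance : PartialOrder (FillSet P) :=
  PartialOrder.lift mem fun _ _ => FillSet.ext

theorem le_def {x y : FillSet P} : x ≤ y ↔ ∀ c b, x.mem c b → y.mem c b := Iff.rfl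

theorem isActive_mono {x y : P → Bool → Prop} (h : ∀ c b, x c b → y c b) {c : P} :
    IsActive x c → IsActive y c :=
  Or.imp_right fun ⟨d, hd, b, hb⟩ => ⟨d, hd, b, h d b hb⟩

instance : Lattice (FillSet P) where
  inf x y :=
    { mem := fun c b => x.mem c b ∧ y.mem c b
      fill := fun c h b b' hb =>
        ⟨x.fill c (isActive_mono (fun _ _ => And.left) h) b b' hb.1,
          y.fill c (isActive_mono (fun _ _ => And.right) h) b b' hb.2⟩ }
  inf_le_left _ _ _ _ := And.left
  inf_le_right _ _ _ _ := And.right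
  le_inf _ _ _ h₁ h₂ c b hb := ⟨h₁ c b hb, h₂ c b hb⟩
  sup x y :=
    { mem := fun c b => (x.mem c b ∨ y.mem c b) ∨
        (IsActive x.mem c ∨ IsActive y.mem c) ∧ ∃ b', x.mem c b' ∨ y.mem c b'
      fill := by
        intro c h b b' hb
        have hne : ∃ b', x.mem c b' ∨ y.mem c b' := hb.elim (fun hb => ⟨b, hb⟩) And.right
        refine Or.inr ⟨?_, hne⟩
        rcases h with h | ⟨d, hd, b, (hx | hy) | ⟨-, b, hx | hy⟩⟩
        · exact Or.inl (Or.inl h)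
        · exact Or.inl (Or.inr ⟨d, hd, b, hx⟩)
        · exact Or.inr (Or.inr ⟨d, hd, b, hy⟩)
        · exact Or.inl (Or.inr ⟨d, hd, b, hx⟩)
        · exact Or.inr (Or.inr ⟨d, hd, b, hy⟩) }
  le_sup_left _ _ _ _ h := Or.inl (Or.inl h)
  le_sup_right _ _ _ _ h := Or.inl (Or.inr h)
  sup_le x y z h₁ h₂ c b hb := by
    rcases hb with hb | ⟨ha, b', hb⟩
    · exact hb.elim (h₁ c b) (h₂ c b)
    · exact z.fill c (ha.elim (isActive_mono h₁) (isActive_mono h₂)) b' b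
        (hb.elim (h₁ c b') (h₂ c b'))

theorem mem_inf {x y : FillSet P} {c : P} {b : Bool} :
    (x ⊓ y).mem c b ↔ x.mem c b ∧ y.mem c b := Iff.rfl

theorem mem_sup {x y : FillSet P} {c : P} {b : Bool} :
    (x ⊔ y).mem c b ↔ (x.mem c b ∨ y.mem c b) ∨
      (IsActive x.mem c ∨ IsActive y.mem c) ∧ ∃ b', x.mem c b' ∨ y.mem c b' := Iff.rfl

theorem exists_mem_sup {x y : FillSet P} {c : P} :
    (∃ b, (x ⊔ y).mem c b) ↔ (∃ b, x.mem c b) ∨ ∃ b, y.mem c b := by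
  simp only [mem_sup]
  grind

theorem isActive_sup {x y : FillSet P} {c : P} :
    IsActive (x ⊔ y).mem c ↔ IsActive x.mem c ∨ IsActive y.mem c := by
  simp only [IsActive, exists_mem_sup]
  grind

theorem mem_sup_iff_of_eq {x y w : FillSet P} {c : P} (b : Bool) (hw : w = x ⊔ y) :
    w.mem c b ↔ (x.mem c b ∨ y.mem c b) ∨ IsActive w.mem c ∧ (x.mem c !b ∨ y.mem c !b) := by
  have hw' := w.fill c
  subst hw
  rw [isActive_sup] at hw' ⊢
  simp only [mem_sup] at hw' ⊢
  cases b <;> simp only [Bool.exists_bool] <;> grind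

theorem mem_not_iff {x : FillSet P} {c : P} (b : Bool) (h : IsActive x.mem c) :
    x.mem c (!b) ↔ x.mem c b := ⟨x.fill c h _ _, x.fill c h _ _⟩

instance [Finite P] : Finite (FillSet P) :=
  Finite.of_injective mem fun _ _ => FillSet.ext

/-! ### Modularity -/

/-- An element that becomes active only at the second step does so because of a coordinate at which
the two other elements were already supported. -/
theorem isActive_step_step {x y z : FillSet P} {c : P}
    (h : IsActive (x ⊔ y ⊓ z ⊔ (y ⊔ x ⊓ z) ⊓ (z ⊔ x ⊓ y)).mem c) :
    IsActive (x ⊔ y ⊓ z).mem c ∨ IsActive y.mem c ∧ IsActive z.mem c := by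
  rcases isActive_sup.1 h with h | h | ⟨d, hd, b, hy, hz⟩
  · exact Or.inl h
  · exact Or.inl (Or.inl h)
  · by_cases hx : ∃ b, (x ⊔ y ⊓ z).mem d b
    · exact Or.inl (Or.inr ⟨d, hd, hx⟩)
    · rw [exists_mem_sup, not_or] at hx
      have hy' := exists_mem_sup.1 ⟨b, hy⟩
      have hz' := exists_mem_sup.1 ⟨b, hz⟩
      simp only [mem_inf] at hx hy' hz'
      exact Or.inr ⟨Or.inr ⟨d, hd, by grind⟩, Or.inr ⟨d, hd, by grind⟩⟩

/-- No element becomes active at the third step. -/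
theorem isActive_step_step_step {x₀ y₀ z₀ x₁ y₁ z₁ x₂ y₂ z₂ : FillSet P} {c : P}
    (hx₁ : x₁ = x₀ ⊔ y₀ ⊓ z₀) (hy₁ : y₁ = y₀ ⊔ x₀ ⊓ z₀) (hz₁ : z₁ = z₀ ⊔ x₀ ⊓ y₀)
    (hx₂ : x₂ = x₁ ⊔ y₁ ⊓ z₁) (hy₂ : y₂ = y₁ ⊔ x₁ ⊓ z₁) (hz₂ : z₂ = z₁ ⊔ x₁ ⊓ y₁)
    (h : IsActive (x₂ ⊔ y₂ ⊓ z₂).mem c) : IsActive x₂.mem c := by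
  rcases isActive_sup.1 h with h | h | ⟨d, hd, b, hy, hz⟩
  · exact h
  · exact Or.inl h
  have hle : ∀ c b, x₀.mem c b → x₂.mem c b := le_def.1 <| by
    rw [hx₂, hx₁]; exact le_sup_left.trans le_sup_left
  by_contra hx
  have hxd : ¬ ∃ b, x₂.mem d b := fun h => hx (Or.inr ⟨d, hd, h⟩)
  have hx₀ : IsActive x₀.mem d → IsMax d := by
    rintro (h | ⟨e, he, b, hb⟩)
    · exact h
    · exact (hx (Or.inr ⟨e, hd.trans he, b, hle e b hb⟩)).elim
  have hay : IsActive y₂.mem d → IsActive y₁.mem d := fun h => by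
    subst hx₁ hy₁ hz₁ hy₂
    rw [inf_comm x₀ y₀] at h
    exact (isActive_step_step h).elim id fun h => Or.inl (hx₀ h.1)
  have haz : IsActive z₂.mem d → IsActive z₁.mem d := fun h => by
    subst hx₁ hy₁ hz₁ hz₂
    rw [inf_comm y₀ z₀, inf_comm x₀ z₀] at h
    exact (isActive_step_step h).elim id fun h => Or.inl (hx₀ h.1)
  subst hx₂ hy₂ hz₂
  simp only [exists_mem_sup, mem_inf] at hxd
  have hy₁' := y₁.fill d
  have hz₁' := z₁.fill d
  rw [isActive_sup] at hay haz
  simp only [mem_sup, mem_inf] at hy hz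
  grind

theorem mem_of_mem_step {x₁ y₁ z₁ x₂ y₂ z₂ x₃ y₃ z₃ : FillSet P} {c : P} {b : Bool}
    (hx₂ : x₂ = x₁ ⊔ y₁ ⊓ z₁) (hy₂ : y₂ = y₁ ⊔ x₁ ⊓ z₁) (hz₂ : z₂ = z₁ ⊔ x₁ ⊓ y₁)
    (hx₃ : x₃ = x₂ ⊔ y₂ ⊓ z₂) (hy₃ : y₃ = y₂ ⊔ x₂ ⊓ z₂) (hz₃ : z₃ = z₂ ⊔ x₂ ⊓ y₂)
    (ay₂ : IsActive y₂.mem c → IsActive y₁.mem c ∨ IsActive x₁.mem c ∧ IsActive z₁.mem c)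
    (az₂ : IsActive z₂.mem c → IsActive z₁.mem c ∨ IsActive x₁.mem c ∧ IsActive y₁.mem c)
    (ay₃ : IsActive y₃.mem c → IsActive y₂.mem c)
    (az₃ : IsActive z₃.mem c → IsActive z₂.mem c)
    (hy : y₃.mem c b) (hz : z₃.mem c b) : x₃.mem c b := by
  have fx₁ := x₁.mem_not_iff (c := c) b
  have fy₁ := y₁.mem_not_iff (c := c) b
  have fz₁ := z₁.mem_not_iff (c := c) b
  have fx₂ := x₂.mem_not_iff (c := c) b
  have fy₂ := y₂.mem_not_iff (c := c) b
  have fz₂ := z₂.mem_not_iff (c := c) b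
  have mx₂ := mem_sup_iff_of_eq (c := c) b hx₂
  have nx₂ := mem_sup_iff_of_eq (c := c) (!b) hx₂
  have my₂ := mem_sup_iff_of_eq (c := c) b hy₂
  have ny₂ := mem_sup_iff_of_eq (c := c) (!b) hy₂
  have mz₂ := mem_sup_iff_of_eq (c := c) b hz₂
  have nz₂ := mem_sup_iff_of_eq (c := c) (!b) hz₂
  have mx₃ := mem_sup_iff_of_eq (c := c) b hx₃
  have nx₃ := mem_sup_iff_of_eq (c := c) (!b) hx₃
  have my₃ := mem_sup_iff_of_eq (c := c) b hy₃
  have ny₃ := mem_sup_iff_of_eq (c := c) (!b) hy₃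
  have mz₃ := mem_sup_iff_of_eq (c := c) b hz₃
  have nz₃ := mem_sup_iff_of_eq (c := c) (!b) hz₃
  simp only [mem_inf, Bool.not_not] at mx₂ nx₂ my₂ ny₂ mz₂ nz₂ mx₃ nx₃ my₃ ny₃ mz₃ nz₃
  clear hx₂ hy₂ hz₂ hx₃ hy₃ hz₃
  grind

theorem nModular_three : NModular (FillSet P) 3 := by
  rintro ⟨x₀, y₀, z₀⟩
  simp only [Function.iterate_succ, Function.iterate_zero, Function.comp_apply, id, adjT]
  generalize hx₁ : x₀ ⊔ y₀ ⊓ z₀ = x₁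
  generalize hy₁ : y₀ ⊔ x₀ ⊓ z₀ = y₁
  generalize hz₁ : z₀ ⊔ x₀ ⊓ y₀ = z₁
  generalize hx₂ : x₁ ⊔ y₁ ⊓ z₁ = x₂
  generalize hy₂ : y₁ ⊔ x₁ ⊓ z₁ = y₂
  generalize hz₂ : z₁ ⊔ x₁ ⊓ y₁ = z₂
  generalize hx₃ : x₂ ⊔ y₂ ⊓ z₂ = x₃
  generalize hy₃ : y₂ ⊔ x₂ ⊓ z₂ = y₃
  generalize hz₃ : z₂ ⊔ x₂ ⊓ y₂ = z₃
  refine le_antisymm le_sup_left (sup_le le_rfl fun c b hb => ?_)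
  refine mem_of_mem_step hx₂.symm hy₂.symm hz₂.symm hx₃.symm hy₃.symm hz₃.symm
    (fun h => ?_) (fun h => ?_) (fun h => ?_) (fun h => ?_) hb.1 hb.2
  · rw [← hy₂, ← hy₁, ← hx₁, ← hz₁, inf_comm x₀ y₀] at h
    exact (isActive_step_step h).imp (fun h => hy₁ ▸ h) fun h =>
      ⟨hx₁ ▸ isActive_sup.2 (Or.inl h.1), hz₁ ▸ isActive_sup.2 (Or.inl h.2)⟩
  · rw [← hz₂, ← hz₁, ← hx₁, ← hy₁, inf_comm y₀ z₀, inf_comm x₀ z₀] at h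
    exact (isActive_step_step h).imp (fun h => hz₁ ▸ h) fun h =>
      ⟨hx₁ ▸ isActive_sup.2 (Or.inl h.1), hy₁ ▸ isActive_sup.2 (Or.inl h.2)⟩
  · rw [← hy₃] at h
    exact isActive_step_step_step hy₁.symm hx₁.symm (hz₁.symm.trans (by rw [inf_comm x₀]))
      hy₂.symm hx₂.symm (hz₂.symm.trans (by rw [inf_comm x₁])) h
  · rw [← hz₃] at h
    exact isActive_step_step_step hz₁.symm (hx₁.symm.trans (by rw [inf_comm y₀]))
      (hy₁.symm.trans (by rw [inf_comm x₀]))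
      hz₂.symm (hx₂.symm.trans (by rw [inf_comm y₁])) (hy₂.symm.trans (by rw [inf_comm x₁])) h

/-! ### Congruences -/

/-- The element whose fibres are full over `S` and empty elsewhere. -/
def full (S : Set P) : FillSet P where
  mem c _ := c ∈ S
  fill _ _ _ _ := id

/-- The element with the single point `(c, b)`, where `c` is not maximal. -/
def point (c : P) (hc : ¬ IsMax c) (b : Bool) : FillSet P where
  mem d b' := d = c ∧ b' = b
  fill d h := by
    rintro b₁ b₂ ⟨rfl, rfl⟩
    rcases h with h | ⟨e, he, _, rfl, -⟩
    · exact (hc h).elim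
    · exact (he.false).elim

theorem mem_full {S : Set P} {c : P} {b : Bool} : (full S).mem c b ↔ c ∈ S := Iff.rfl

theorem full_empty_le (x : FillSet P) : full ∅ ≤ x := fun _ _ h => h.elim

theorem full_sup_full (S T : Set P) : full S ⊔ full T = full (S ∪ T) := by
  ext c b
  simp only [mem_sup, mem_full, Set.mem_union, exists_const]
  tauto

/-- If `c < d`, joining with `full {d}` fills the fibre over `c`. -/
theorem full_sup_point {c d : P} (h : c < d) (b : Bool) :
    full {d} ⊔ point c h.not_isMax b = full {d} ⊔ full {c} := by
  have ha : IsActive (full {d}).mem c := Or.inr ⟨d, h, true, rfl⟩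
  ext e b'
  simp only [mem_sup, mem_full, Set.mem_singleton_iff, point]
  grind

theorem isLatCon_eq_off (S : LowerSet P) :
    IsLatCon fun x y : FillSet P => ∀ c ∉ S, ∀ b, x.mem c b ↔ y.mem c b := by
  refine ⟨⟨fun _ _ _ _ => Iff.rfl, fun h c hc b => (h c hc b).symm,
    fun h₁ h₂ c hc b => (h₁ c hc b).trans (h₂ c hc b)⟩, fun x y z h c hc b => ?_,
    fun x y z h c hc b => ?_⟩
  · have ha : IsActive x.mem c ↔ IsActive y.mem c := or_congr_right <| exists_congr fun d =>
      and_congr_right fun hd => exists_congr fun b => h d (fun hS => hc (S.lower hd.le hS)) b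
    simp only [mem_sup, h c hc, ha]
  · simp only [mem_inf, h c hc]

variable {Θ : FillSet P → FillSet P → Prop}

theorem rel_full_singleton_of_mem (hΘ : IsLatCon Θ) {x y : FillSet P} (h : Θ x y) {c : P}
    {b : Bool} (hx : x.mem c b) (hy : ¬ y.mem c b) : Θ (full {c}) (full ∅) := by
  obtain ⟨-, hs, hi⟩ := hΘ
  by_cases hc : IsMax c
  · convert hi x y (full {c}) h using 1
    · ext d b'
      have := x.fill c (Or.inl hc) b b'
      simp only [mem_inf, mem_full, Set.mem_singleton_iff]
      grind
    · ext d b'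
      have := y.fill c (Or.inl hc) b' b
      simp only [mem_inf, mem_full, Set.mem_singleton_iff, Set.mem_empty_iff_false]
      grind
  · have h₁ : Θ (point c hc b) (full ∅) := by
      convert hi x y (point c hc b) h using 1
      · ext d b'
        simp only [mem_inf, point]
        grind
      · ext d b'
        simp only [mem_inf, point, mem_full, Set.mem_empty_iff_false]
        grind
    obtain ⟨d, hd⟩ := not_isMax_iff.1 hc
    have h₂ := hi _ _ (full {c}) (hs _ _ (full {d}) h₁)
    rw [sup_comm, full_sup_point hd, sup_eq_right.2 (full_empty_le _),
      inf_eq_right.2 le_sup_right] at h₂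
    convert h₂ using 1
    ext e b'
    simp only [mem_inf, mem_full, Set.mem_singleton_iff, Set.mem_empty_iff_false]
    grind [hd.ne]

theorem rel_full_singleton_of_lt (hΘ : IsLatCon Θ) {c d : P} (hcd : c < d)
    (h : Θ (full {d}) (full ∅)) : Θ (full {c}) (full ∅) := by
  have h₁ := hΘ.2.1 _ _ (point c hcd.not_isMax false) h
  rw [full_sup_point hcd, sup_eq_right.2 (full_empty_le _)] at h₁
  exact rel_full_singleton_of_mem hΘ h₁ (c := c) (b := true)
    (Or.inl (Or.inr rfl)) fun h => by simpa using h.2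

theorem rel_full_of_forall [Finite P] (hΘ : IsLatCon Θ) (S : Set P)
    (h : ∀ c ∈ S, Θ (full {c}) (full ∅)) : Θ (full S) (full ∅) := by
  induction S, S.toFinite using Set.Finite.induction_on with
  | empty => exact hΘ.1.refl _
  | @insert c S _ _ ih =>
    have h₁ := hΘ.2.1 _ _ (full S) (h c (Set.mem_insert c S))
    rw [full_sup_full, sup_eq_right.2 (full_empty_le _), Set.singleton_union] at h₁
    exact hΘ.1.trans h₁ (ih fun c hc => h c (Set.mem_insert_of_mem _ hc))

/-- The lower set of coordinates collapsed by a congruence. -/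
def collapsed (hΘ : IsLatCon Θ) : LowerSet P where
  carrier := {c | Θ (full {c}) (full ∅)}
  lower' _ _ hcd hd := hcd.eq_or_lt.elim (fun h => h ▸ hd)
    fun h => rel_full_singleton_of_lt hΘ h hd

theorem rel_iff_eq_off_collapsed [Finite P] (hΘ : IsLatCon Θ) (x y : FillSet P) :
    Θ x y ↔ ∀ c ∉ collapsed hΘ, ∀ b, x.mem c b ↔ y.mem c b := by
  refine ⟨fun h c hc b => ⟨fun hx => ?_, fun hy => ?_⟩, fun h => ?_⟩
  · exact by_contra fun hy => hc (rel_full_singleton_of_mem hΘ h hx hy)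
  · exact by_contra fun hx => hc (rel_full_singleton_of_mem hΘ (hΘ.1.symm h) hy hx)
  · have hS := rel_full_of_forall hΘ (collapsed hΘ : Set P) fun _ hc => hc
    have key (w : FillSet P) : Θ (full (collapsed hΘ : Set P) ⊔ w) w := by
      have := hΘ.2.1 _ _ w hS
      rwa [sup_eq_right.2 (full_empty_le w)] at this
    have heq : full (collapsed hΘ : Set P) ⊔ x = full (collapsed hΘ : Set P) ⊔ y := by
      ext c b
      by_cases hc : c ∈ collapsed hΘ
      · exact ⟨fun _ => Or.inl (Or.inl hc), fun _ => Or.inl (Or.inl hc)⟩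
      · have h₁ := (isLatCon_eq_off (collapsed hΘ)).2.1 x y (full (collapsed hΘ : Set P)) h c hc b
        rwa [sup_comm x, sup_comm y] at h₁
    exact hΘ.1.trans (hΘ.1.symm (key x)) (heq ▸ key y)

theorem le_iff_eq_off_imp {S T : LowerSet P} :
    S ≤ T ↔ ∀ x y : FillSet P, (∀ c ∉ S, ∀ b, x.mem c b ↔ y.mem c b) →
      ∀ c ∉ T, ∀ b, x.mem c b ↔ y.mem c b := by
  refine ⟨fun h x y hxy c hc => hxy c fun hS => hc (h hS), fun h c hS => ?_⟩
  by_contra hT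
  exact (h (full {c}) (full ∅) (fun d hd b => iff_of_false (fun h => hd (h ▸ hS)) id) c hT
    true).1 rfl

/-- The congruences of `FillSet P` correspond to the lower sets of `P`. -/
def lowerSetOrderIsoCon [Finite P] :
    LowerSet P ≃o {Θ : FillSet P → FillSet P → Prop // IsLatCon Θ} where
  toFun S := ⟨_, isLatCon_eq_off S⟩
  invFun Θ := collapsed Θ.2
  left_inv S := by
    have h := rel_iff_eq_off_collapsed (isLatCon_eq_off S)
    exact le_antisymm (le_iff_eq_off_imp.2 fun x y => (h x y).2)
      (le_iff_eq_off_imp.2 fun x y => (h x y).1)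
  right_inv Θ := Subtype.ext <| funext₂ fun x y =>
    propext (rel_iff_eq_off_collapsed Θ.2 x y).symm
  map_rel_iff' := le_iff_eq_off_imp.symm

end FillSet

/-- Every finite distributive lattice `D` is isomorphic to the congruence lattice
(congruences ordered by inclusion) of some finite `3`-modular lattice. -/
theorem stmt19 (D : Type*) [DistribLattice D] [Fintype D] [Nonempty D] :
    ∃ (α : Type) (_ : Lattice α), Finite α ∧ NModular α 3 ∧
      Nonempty (D ≃o {Θ : α → α → Prop // IsLatCon Θ}) := by
  classical
  let _ : OrderBot D := Fintype.toOrderBot D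
  let e := (equivShrink.{0} {a : D // SupIrred a}).symm
  let _ : PartialOrder (Shrink.{0} {a : D // SupIrred a}) := PartialOrder.lift e e.injective
  have : Finite (Shrink.{0} {a : D // SupIrred a}) := Finite.of_equiv _ e.symm
  let f : Shrink.{0} {a : D // SupIrred a} ≃o {a : D // SupIrred a} := ⟨e, Iff.rfl⟩
  exact ⟨FillSet (Shrink.{0} {a : D // SupIrred a}), inferInstance, inferInstance,
    FillSet.nModular_three,
    ⟨OrderIso.lowerSetSupIrred.trans ((LowerSet.map f.symm).trans FillSet.lowerSetOrderIsoCon)⟩⟩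
end
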